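/- Let a_n be the coefficient of q^n in ∏_{m=1}^∞ (1 - q^m)^{26}. For every prime p with p ≡ 1 (mod 12), let (u, v) be the unique pair of positive integers with p = u^2 + v^2, u odd and v even, let (x, y) be the unique pair of positive integers with p = x^2 + 3y^2, and set κ = u if u ≡ 0 (mod 3) and κ = v otherwise. Then 1019304 · a_{(p−13)/12} = (−1)^{κ} · (u^2 − x^2)(v^2 − x^2)·((2u + x)^2 − 9y^2)·((2u − x)^2 − 9y^2)·((2v + x)^2 − 9y^2)·((2v − x)^2 − 9y^2). -/

import Mathlib

section

open UpperHalfPlane hiding I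
open Complex Filter Topology EisensteinSeries Derivative PowerSeries
open scoped Manifold MatrixGroups ModularForm Real

/-- Invariance under the two generators of the modular group, in pointwise form. -/
structure IsModular (k : ℕ) (F : ℍ → ℂ) : Prop where
  mdiff : MDiff F
  S : ∀ z, F (ModularGroup.S • z) = (z : ℂ) ^ k * F z
  T : ∀ z, F (ModularGroup.T • z) = F z

theorem slash_S_apply (k : ℤ) (F : ℍ → ℂ) (z : ℍ) :
    (F ∣[k] ModularGroup.S) z = F (ModularGroup.S • z) * (z : ℂ) ^ (-k) := by
  rw [ModularForm.SL_slash_apply, ModularGroup.denom_S]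

theorem slash_T_apply (k : ℤ) (F : ℍ → ℂ) (z : ℍ) :
    (F ∣[k] ModularGroup.T) z = F (ModularGroup.T • z) := by
  rw [ModularForm.SL_slash_apply, ModularGroup.denom_apply]
  simp [ModularGroup.T]

theorem slash_S_eq_iff (k : ℕ) (F : ℍ → ℂ) :
    F ∣[(k : ℤ)] ModularGroup.S = F ↔ ∀ z, F (ModularGroup.S • z) = (z : ℂ) ^ k * F z := by
  rw [funext_iff]
  refine forall_congr' fun z => ?_
  rw [slash_S_apply]
  have := z.ne_zero
  simp only [zpow_neg, zpow_natCast]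
  field_simp

theorem slash_T_eq_iff (k : ℤ) (F : ℍ → ℂ) :
    F ∣[k] ModularGroup.T = F ↔ ∀ z, F (ModularGroup.T • z) = F z := by
  rw [funext_iff]
  exact forall_congr' fun z => by rw [slash_T_apply]

theorem IsModular.eq_zero {k : ℕ} (hk : k < 12) {F : ℍ → ℂ} (h : IsModular k F)
    (h0 : Tendsto F atImInfty (𝓝 0)) : F = 0 := by
  have hS := (slash_S_eq_iff k F).2 h.S
  have hT := (slash_T_eq_iff k F).2 h.T
  let f : CuspForm 𝒮ℒ (k : ℤ) :=
    { toFun := F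
      slash_action_eq' := by
        intro A hA
        obtain ⟨A, rfl⟩ := hA
        exact SlashInvariantForm.slash_action_generators_SL2Z hS hT A
      holo' := h.mdiff
      zero_at_cusps' := by
        intro c hc
        rw [Subgroup.IsArithmetic.isCusp_iff_isCusp_SL2Z] at hc
        rw [OnePoint.isZeroAt_iff_forall_SL2Z hc]
        intro γ _
        rw [SlashInvariantForm.slash_action_generators_SL2Z hS hT]
        exact h0 }
  have hf : f = 0 := rank_zero_iff_forall_zero.1
    (CuspForm.rank_eq_zero_of_weight_lt_twelve (by exact_mod_cast hk)) f
  have : (f : ℍ → ℂ) = 0 := by rw [hf]; rfl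
  exact this

theorem IsModular.smul {k : ℕ} {F : ℍ → ℂ} (c : ℂ) (h : IsModular k F) :
    IsModular k (c • F) where
  mdiff := h.mdiff.const_smul c
  S z := by simp only [Pi.smul_apply, h.S, smul_eq_mul]; ring
  T z := by simp only [Pi.smul_apply, h.T]

theorem IsModular.sub {k : ℕ} {F G : ℍ → ℂ} (h : IsModular k F) (h' : IsModular k G) :
    IsModular k (F - G) where
  mdiff := h.mdiff.sub h'.mdiff
  S z := by simp only [Pi.sub_apply, h.S, h'.S]; ring
  T z := by simp only [Pi.sub_apply, h.T, h'.T]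

theorem IsModular.mul {k l : ℕ} {F G : ℍ → ℂ} (h : IsModular k F) (h' : IsModular l G) :
    IsModular (k + l) (F * G) where
  mdiff := h.mdiff.mul h'.mdiff
  S z := by simp only [Pi.mul_apply, h.S, h'.S]; ring
  T z := by simp only [Pi.mul_apply, h.T, h'.T]

theorem IsModular.eq_smul {k : ℕ} (hk : k < 12) {F G : ℍ → ℂ} (h : IsModular k F)
    (h' : IsModular k G) {c : ℂ} (hF : Tendsto F atImInfty (𝓝 c))
    (hG : Tendsto G atImInfty (𝓝 1)) : F = c • G := by
  refine sub_eq_zero.1 ((h.sub (h'.smul c)).eq_zero hk ?_)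
  have := hF.sub (hG.const_smul c)
  simp only [smul_eq_mul, mul_one, sub_self] at this
  exact this

theorem E2_SL_smul (γ : SL(2, ℤ)) (z : ℍ) :
    E2 (γ • z) = denom γ z ^ 2 * E2 z + 6 / (π * I) * γ 1 0 * denom γ z := by
  have h := congrFun (E2_slash_action γ) z
  have hd : denom γ z ≠ 0 := denom_ne_zero _ _
  have hpi : (π : ℂ) ≠ 0 := by exact_mod_cast Real.pi_ne_zero
  rw [ModularForm.SL_slash_apply] at h
  simp only [Pi.sub_apply, Pi.smul_apply, D2, riemannZeta_two, smul_eq_mul, zpow_neg] at h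
  have h2 : E2 (γ • z) = denom γ z ^ 2 * (E2 (γ • z) * (denom γ z ^ (2 : ℤ))⁻¹) := by
    rw [show ((2 : ℤ)) = ((2 : ℕ) : ℤ) from rfl, zpow_natCast]
    field_simp
  rw [h2, h]
  field_simp
  linear_combination (-6 * γ 1 0) * I_sq

theorem E2_S_smul (z : ℍ) :
    E2 (ModularGroup.S • z) = (z : ℂ) ^ 2 * E2 z + 6 / (π * I) * z := by
  rw [E2_SL_smul, ModularGroup.denom_S]
  simp [ModularGroup.S]

theorem E2_T_smul (z : ℍ) : E2 (ModularGroup.T • z) = E2 z := by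
  rw [E2_SL_smul, ModularGroup.denom_apply]
  simp [ModularGroup.T]

theorem D_S_smul {F : ℍ → ℂ} (hF : MDiff F) (k : ℤ) (z : ℍ) :
    D F (ModularGroup.S • z) = (z : ℂ) ^ (k + 2) * (D (F ∣[k] ModularGroup.S) z +
      k / (2 * π * I * z) * (F ∣[k] ModularGroup.S) z) := by
  have h := congrFun (normalizedDerivOfComplex_SL_slash (k := k) hF (γ := ModularGroup.S)) z
  have hz := z.ne_zero
  rw [Pi.sub_apply, slash_S_apply, ModularGroup.denom_S,
    show ModularGroup.S 1 0 = 1 by simp [ModularGroup.S]] at h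
  rw [h, zpow_neg]
  have hz' : (z : ℂ) ^ (k + 2) ≠ 0 := zpow_ne_zero _ hz
  have hpi : (π : ℂ) ≠ 0 := by exact_mod_cast Real.pi_ne_zero
  have := I_ne_zero
  simp only [Int.cast_one]
  field_simp
  ring

theorem D_T_smul {F : ℍ → ℂ} (hF : MDiff F) (hT : ∀ z, F (ModularGroup.T • z) = F z) (z : ℍ) :
    D F (ModularGroup.T • z) = D F z := by
  have h := congrFun (normalizedDerivOfComplex_SL_slash (k := 0) hF (γ := ModularGroup.T)) z
  rw [(slash_T_eq_iff 0 F).2 hT, Pi.sub_apply, slash_T_apply] at h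
  simpa using h.symm

theorem D_coe_inv (z : ℍ) : D (fun z : ℍ => (z : ℂ)⁻¹) z = - (2 * π * I * (z : ℂ) ^ 2)⁻¹ := by
  have h : ((fun z : ℍ => (z : ℂ)⁻¹) ∘ ofComplex) =ᶠ[𝓝 (z : ℂ)] fun w => w⁻¹ := by
    filter_upwards [isOpen_upperHalfPlaneSet.mem_nhds z.2] with w hw
    simp [ofComplex_apply_of_im_pos hw]
  rw [normalizedDerivOfComplex, h.deriv_eq, deriv_inv]
  simp only [mul_inv]
  ring

theorem E2_slash_S : E2 ∣[(2 : ℤ)] ModularGroup.S =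
    E2 + (6 / (π * I)) • fun z : ℍ => (z : ℂ)⁻¹ := by
  ext z
  have hz := z.ne_zero
  rw [slash_S_apply, E2_S_smul, zpow_neg, show ((2 : ℤ)) = ((2 : ℕ) : ℤ) from rfl, zpow_natCast]
  simp only [Pi.add_apply, Pi.smul_apply, smul_eq_mul]
  field_simp

theorem D_E2_isModular : IsModular 4 (D E2 - (1 / 12 : ℂ) • E2 ^ 2) where
  mdiff := (normalizedDerivOfComplex_mdifferentiable E2_mdifferentiable).sub
    ((E2_mdifferentiable.pow 2).const_smul _)
  T z := by
    simp only [Pi.sub_apply, Pi.smul_apply, Pi.pow_apply,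
      D_T_smul E2_mdifferentiable E2_T_smul, E2_T_smul]
  S z := by
    have hinv : MDiff (fun z : ℍ => (z : ℂ)⁻¹) := by
      rw [UpperHalfPlane.mdifferentiable_iff]
      intro w hw
      refine (DifferentiableAt.differentiableWithinAt ?_).congr (f := fun w => w⁻¹) ?_ ?_
      · exact differentiableAt_inv (fun h => by simp [h] at hw)
      · intro x hx
        simp [ofComplex_apply_of_im_pos hx]
      · simp [ofComplex_apply_of_im_pos hw]
    simp only [Pi.sub_apply, Pi.smul_apply, Pi.pow_apply, D_S_smul E2_mdifferentiable 2 z]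
    rw [E2_slash_S, normalizedDerivOfComplex_add _ _ E2_mdifferentiable (hinv.const_smul _),
      normalizedDerivOfComplex_smul _ _ hinv, E2_S_smul]
    simp only [Pi.add_apply, Pi.smul_apply, smul_eq_mul, D_coe_inv]
    have hz := z.ne_zero
    have hpi : (π : ℂ) ≠ 0 := by exact_mod_cast Real.pi_ne_zero
    have hI := I_ne_zero
    rw [show ((2 : ℤ) + 2) = ((4 : ℕ) : ℤ) from rfl, zpow_natCast]
    push_cast
    field_simp
    ring

theorem IsModular.serreDerivative {k : ℕ} {F : ℍ → ℂ} (h : IsModular k F) :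
    IsModular (k + 2) (D F - (k / 12 : ℂ) • (E2 * F)) where
  mdiff := (normalizedDerivOfComplex_mdifferentiable h.mdiff).sub
    ((E2_mdifferentiable.mul h.mdiff).const_smul _)
  T z := by
    simp only [Pi.sub_apply, Pi.smul_apply, Pi.mul_apply,
      D_T_smul h.mdiff h.T, E2_T_smul, h.T]
  S z := by
    simp only [Pi.sub_apply, Pi.smul_apply, Pi.mul_apply, D_S_smul h.mdiff k z]
    rw [(slash_S_eq_iff k F).2 h.S, E2_S_smul, h.S]
    have hz := z.ne_zero
    have hpi : (π : ℂ) ≠ 0 := by exact_mod_cast Real.pi_ne_zero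
    have hI := I_ne_zero
    rw [show ((k : ℤ) + 2) = ((k + 2 : ℕ) : ℤ) from by push_cast; rfl, zpow_natCast]
    simp only [smul_eq_mul]
    push_cast
    field_simp
    ring

/-- The Euler derivation `q d/dq` on power series. -/
noncomputable def eulerD : Derivation ℂ ℂ⟦X⟧ ℂ⟦X⟧ := (X : ℂ⟦X⟧) • PowerSeries.derivative ℂ

theorem coeff_eulerD (f : ℂ⟦X⟧) (n : ℕ) : coeff n (eulerD f) = n * coeff n f := by
  rw [eulerD, Derivation.smul_apply, smul_eq_mul]
  cases n with
  | zero => simp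
  | succ n => rw [coeff_succ_X_mul, coeff_derivative]; push_cast; ring

/-- `F` is given on the upper half plane by the `q`-series with coefficients those of `c`. -/
def IsQSeries (F : ℍ → ℂ) (c : ℂ⟦X⟧) : Prop :=
  ∀ τ : ℍ, HasSum (fun n : ℕ => c.coeff n * cexp (2 * π * I * τ) ^ n) (F τ)

theorem norm_cexp_coe (τ : ℂ) : ‖cexp (2 * π * I * τ)‖ = Real.exp (-2 * π * τ.im) := by
  rw [Complex.norm_exp]
  congr 1
  simp

namespace IsQSeries

variable {F G : ℍ → ℂ} {c d : ℂ⟦X⟧}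

theorem add (h : IsQSeries F c) (h' : IsQSeries G d) : IsQSeries (F + G) (c + d) := by
  intro τ
  simpa [add_mul] using (h τ).add (h' τ)

theorem smul (a : ℂ) (h : IsQSeries F c) : IsQSeries (a • F) (a • c) := by
  intro τ
  simpa [mul_assoc] using (h τ).mul_left a

theorem sub (h : IsQSeries F c) (h' : IsQSeries G d) : IsQSeries (F - G) (c - d) := by
  intro τ
  simpa [sub_mul] using (h τ).sub (h' τ)

theorem mul (h : IsQSeries F c) (h' : IsQSeries G d) : IsQSeries (F * G) (c * d) := by
  intro τ
  have h1 := (h τ).summable.norm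
  have h2 := (h' τ).summable.norm
  have key := tsum_mul_tsum_eq_tsum_sum_antidiagonal_of_summable_norm h1 h2
  have hs := (summable_norm_sum_mul_antidiagonal_of_summable_norm h1 h2).of_norm
  rw [(h τ).tsum_eq, (h' τ).tsum_eq] at key
  rw [Pi.mul_apply, key]
  refine hs.hasSum.congr_fun ?_
  intro n
  rw [PowerSeries.coeff_mul, Finset.sum_mul]
  refine Finset.sum_congr rfl fun x hx => ?_
  rw [← Finset.HasAntidiagonal.mem_antidiagonal.1 hx, pow_add]
  ring

theorem pow (h : IsQSeries F c) (n : ℕ) : IsQSeries (F ^ (n + 1)) (c ^ (n + 1)) := by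
  induction n with
  | zero => simpa using h
  | succ n ih => rw [pow_succ F, pow_succ c]; exact ih.mul h

theorem unique (h : IsQSeries F c) (h' : IsQSeries F d) : c = d := by
  have h0 := h.sub h'
  rw [sub_self] at h0
  have key : ∀ e : ℂ⟦X⟧, IsQSeries 0 e → ∀ n, e.coeff n =
      (UpperHalfPlane.qExpansion 1 (0 : ModularForm 𝒮ℒ 0)).coeff n := fun e he =>
    ModularFormClass.qExpansion_coeff_unique (f := (0 : ModularForm 𝒮ℒ 0)) (c := fun n => e.coeff n)
      one_pos one_mem_strictPeriods_SL (fun τ => by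
        simpa [Function.Periodic.qParam] using he τ)
  refine sub_eq_zero.1 (PowerSeries.ext fun n => ?_)
  rw [key _ h0 n, key 0 fun τ => by simp]

theorem tendsto (h : IsQSeries F c) : Tendsto F atImInfty (𝓝 (c.coeff 0)) := by
  have hI := (h UpperHalfPlane.I).summable.norm
  have key : Tendsto (fun τ : ℍ => ∑' n : ℕ, c.coeff n * cexp (2 * π * I * τ) ^ n) atImInfty
      (𝓝 (∑' n : ℕ, if n = 0 then c.coeff 0 else 0)) := by
    refine tendsto_tsum_of_dominated_convergence hI (fun n => ?_) ?_
    · rcases n with _ | n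
      · simp
      · simp only [Nat.add_eq_zero_iff, one_ne_zero, and_false, if_false]
        have := (UpperHalfPlane.qParam_tendsto_atImInfty one_pos)
        simp only [Function.Periodic.qParam, ofReal_one, div_one] at this
        simpa using (this.pow (n + 1)).const_mul (c.coeff (n + 1))
    · have : ∀ᶠ τ : ℍ in atImInfty, 1 ≤ τ.im :=
        (atImInfty_mem _).2 ⟨1, fun τ hτ => hτ⟩
      filter_upwards [this] with τ hτ n
      rw [norm_mul, norm_mul, norm_pow, norm_pow, norm_cexp_coe, norm_cexp_coe]
      gcongr ?_ * ?_ ^ n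
      apply Real.exp_le_exp.2
      simp only [coe_im, UpperHalfPlane.I_im]
      nlinarith [Real.pi_pos]
  rw [tsum_ite_eq] at key
  exact key.congr fun τ => (h τ).tsum_eq

theorem hasDerivAt_comp_ofComplex (h : IsQSeries F c) (τ : ℍ) :
    DifferentiableAt ℂ (F ∘ ofComplex) τ ∧
      HasSum (fun n : ℕ => (eulerD c).coeff n * cexp (2 * π * I * τ) ^ n) (D F τ) := by
  let σ : ℍ := ⟨I * (τ.im / 2 : ℝ), by simpa using τ.im_pos⟩
  let U : Set ℂ := {w | τ.im / 2 < w.im}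
  have hU : IsOpen U := isOpen_lt continuous_const Complex.continuous_im
  have hτ : (τ : ℂ) ∈ U := half_lt_self τ.im_pos
  let f : ℕ → ℂ → ℂ := fun n w => c.coeff n * cexp (2 * π * I * w) ^ n
  have hf : ∀ n w, HasDerivAt (f n)
      (c.coeff n * (n * cexp (2 * π * I * w) ^ n * (2 * π * I))) w := by
    intro n w
    have h1 : HasDerivAt (fun w => cexp (2 * π * I * w))
        (cexp (2 * π * I * w) * (2 * π * I)) w := by
      simpa using ((hasDerivAt_id w).const_mul (2 * π * I)).cexp
    refine ((h1.fun_pow n).const_mul (c.coeff n)).congr_deriv ?_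
    rcases n with _ | n
    · simp
    · rw [Nat.add_sub_cancel]
      ring
  have hle : ∀ n w, w ∈ U → ‖f n w‖ ≤ ‖c.coeff n * cexp (2 * π * I * σ) ^ n‖ := by
    intro n w hw
    simp only [f]
    rw [norm_mul, norm_mul, norm_pow, norm_pow, norm_cexp_coe, norm_cexp_coe]
    gcongr ?_ * ?_ ^ n
    apply Real.exp_le_exp.2
    have : τ.im / 2 < w.im := hw
    have h2 : (σ : ℂ).im = τ.im / 2 := by simp [σ]
    rw [h2]
    nlinarith [Real.pi_pos]
  have hdiff : ∀ n, DifferentiableOn ℂ (f n) U := fun n w _ =>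
    (hf n w).differentiableAt.differentiableWithinAt
  have hu := (h σ).summable.norm
  have hev : F ∘ ofComplex =ᶠ[𝓝 (τ : ℂ)] fun w => ∑' n, f n w := by
    filter_upwards [isOpen_upperHalfPlaneSet.mem_nhds τ.2] with w hw
    rw [Function.comp_apply, ofComplex_apply_of_im_pos hw, ← (h ⟨w, hw⟩).tsum_eq]
  have hd := hasSum_deriv_of_summable_norm hu hdiff hU hle hτ
  constructor
  · exact ((differentiableOn_tsum_of_summable_norm hu hdiff hU hle).differentiableAt
      (hU.mem_nhds hτ)).congr_of_eventuallyEq hev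
  · rw [normalizedDerivOfComplex, hev.deriv_eq]
    refine (hd.mul_left _).congr_fun fun n => ?_
    rw [(hf n _).deriv, coeff_eulerD]
    have : (2 * π * I : ℂ) ≠ 0 := two_pi_I_ne_zero
    field_simp

theorem eulerD (h : IsQSeries F c) : IsQSeries (D F) (eulerD c) :=
  fun τ => (h.hasDerivAt_comp_ofComplex τ).2

theorem double (h : IsQSeries F c) {g : ℍ → ℍ} (hg : ∀ τ, (g τ : ℂ) = 2 * τ) :
    IsQSeries (F ∘ g) (expand 2 two_ne_zero c) := by
  intro τ
  have h1 := h (g τ)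
  have hinj : Function.Injective fun n : ℕ => 2 * n := fun a b hab => by simpa using hab
  rw [Function.comp_apply, ← hinj.hasSum_iff]
  · refine h1.congr_fun fun n => ?_
    rw [Function.comp_apply, coeff_expand_mul, pow_mul, ← Complex.exp_nat_mul, hg]
    congr 3
    push_cast
    ring
  · intro n hn
    rw [coeff_expand_of_not_dvd, zero_mul]
    rintro ⟨m, rfl⟩
    exact hn ⟨m, rfl⟩

end IsQSeries

/-- The `q`-expansion of the quasimodular Eisenstein series of weight two. -/
noncomputable def e2Series : ℂ⟦X⟧ :=
  PowerSeries.mk fun n => if n = 0 then 1 else -24 * ArithmeticFunction.sigma 1 n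

theorem isQSeries_E2 : IsQSeries E2 e2Series := by
  intro τ
  have := hasSum_qExpansion_E2 (z := τ)
  simpa only [e2Series, coeff_mk, Function.Periodic.qParam, ofReal_one, div_one, smul_eq_mul]
    using this

/-- The weight four Eisenstein series, as defined by Ramanujan's identity for `D E2`. -/
noncomputable def fourE : ℍ → ℂ := E2 ^ 2 - (12 : ℂ) • D E2

/-- The weight six Eisenstein series, as defined by Ramanujan's identity for `D E4`. -/
noncomputable def sixE : ℍ → ℂ := E2 * fourE - (3 : ℂ) • D fourE

noncomputable def e4Series : ℂ⟦X⟧ := e2Series ^ 2 - (12 : ℂ) • eulerD e2Series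

noncomputable def e6Series : ℂ⟦X⟧ := e2Series * e4Series - (3 : ℂ) • eulerD e4Series

theorem isModular_fourE : IsModular 4 fourE := by
  have := D_E2_isModular.smul (-12)
  convert this using 1
  ext z
  simp [fourE]
  ring

theorem isModular_sixE : IsModular 6 sixE := by
  have := isModular_fourE.serreDerivative.smul (-3)
  convert this using 1
  ext z
  simp [sixE]
  ring

theorem isQSeries_fourE : IsQSeries fourE e4Series :=
  (isQSeries_E2.pow 1).sub (isQSeries_E2.eulerD.smul 12)

theorem isQSeries_sixE : IsQSeries sixE e6Series :=
  (isQSeries_E2.mul isQSeries_fourE).sub (isQSeries_fourE.eulerD.smul 3)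

theorem coeff_zero_e2Series : coeff 0 e2Series = 1 := by simp [e2Series, coeff_mk]

theorem coeff_zero_e4Series : coeff 0 e4Series = 1 := by
  rw [e4Series, map_sub, pow_two, map_smul, coeff_eulerD, coeff_mul]
  simp [-coeff_zero_eq_constantCoeff, coeff_zero_e2Series]

theorem coeff_zero_e6Series : coeff 0 e6Series = 1 := by
  rw [e6Series, map_sub, map_smul, coeff_eulerD, coeff_mul]
  simp [-coeff_zero_eq_constantCoeff, coeff_zero_e2Series, coeff_zero_e4Series]

theorem tendsto_E2 : Tendsto E2 atImInfty (𝓝 1) :=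
  coeff_zero_e2Series ▸ isQSeries_E2.tendsto

theorem tendsto_fourE : Tendsto fourE atImInfty (𝓝 1) :=
  coeff_zero_e4Series ▸ isQSeries_fourE.tendsto

theorem tendsto_sixE : Tendsto sixE atImInfty (𝓝 1) :=
  coeff_zero_e6Series ▸ isQSeries_sixE.tendsto

theorem ofNat_smul_series (n : ℕ) [n.AtLeastTwo] (c : ℂ⟦X⟧) :
    (OfNat.ofNat n : ℂ) • c = OfNat.ofNat n * c := by
  rw [smul_eq_C_mul, map_ofNat]

theorem eulerD_e2Series : 12 * eulerD e2Series = e2Series ^ 2 - e4Series := by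
  rw [e4Series, ofNat_smul_series]
  ring

theorem eulerD_e4Series : 3 * eulerD e4Series = e2Series * e4Series - e6Series := by
  rw [e6Series, ofNat_smul_series]
  ring

theorem eulerD_e6Series :
    2 * eulerD e6Series = e2Series * e6Series - e4Series ^ 2 := by
  have hq : IsQSeries (D sixE - ((6 : ℕ) / 12 : ℂ) • (E2 * sixE))
      (eulerD e6Series - ((6 : ℕ) / 12 : ℂ) • (e2Series * e6Series)) :=
    isQSeries_sixE.eulerD.sub ((isQSeries_E2.mul isQSeries_sixE).smul _)
  have hlim := hq.tendsto
  have h0 : coeff 0 (eulerD e6Series - ((6 : ℕ) / 12 : ℂ) • (e2Series * e6Series)) = -1 / 2 := by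
    rw [map_sub, map_smul, coeff_eulerD, coeff_mul]
    simp [-coeff_zero_eq_constantCoeff, coeff_zero_e2Series, coeff_zero_e6Series]
    norm_num
  rw [h0] at hlim
  have hG : Tendsto (fourE * fourE) atImInfty (𝓝 1) := by
    have := tendsto_fourE.mul tendsto_fourE
    rw [mul_one] at this
    exact this
  have key := isModular_sixE.serreDerivative.eq_smul (by norm_num)
    (isModular_fourE.mul isModular_fourE) hlim hG
  rw [key] at hq
  have h := hq.unique ((isQSeries_fourE.mul isQSeries_fourE).smul (-1 / 2))
  rw [sub_eq_iff_eq_add] at h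
  rw [h, ← ofNat_smul_series, pow_two]
  module

/-- The affine map `τ ↦ a τ + b` of the upper half plane, for `0 < a`. -/
noncomputable def affineH (a : ℝ) (ha : 0 < a) (b : ℝ) (τ : ℍ) : ℍ :=
  ⟨a * τ + b, by simpa using mul_pos ha τ.im_pos⟩

theorem coe_affineH (a : ℝ) (ha : 0 < a) (b : ℝ) (τ : ℍ) :
    (affineH a ha b τ : ℂ) = a * τ + b := rfl

theorem mdifferentiable_comp_affineH {F : ℍ → ℂ} (hF : MDiff F) (a : ℝ) (ha : 0 < a) (b : ℝ) :
    MDiff (F ∘ affineH a ha b) := by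
  rw [UpperHalfPlane.mdifferentiable_iff] at hF ⊢
  have hmaps : Set.MapsTo (fun w : ℂ => a * w + b) upperHalfPlaneSet upperHalfPlaneSet := by
    intro w hw
    simpa using mul_pos ha hw
  refine (hF.comp (f := fun w : ℂ => a * w + b) (by fun_prop) hmaps).congr fun w hw => ?_
  simp only [Function.comp_apply]
  rw [ofComplex_apply_of_im_pos hw, ofComplex_apply_of_im_pos (hmaps hw)]
  rfl

theorem tendsto_affineH (a : ℝ) (ha : 0 < a) (b : ℝ) :
    Tendsto (affineH a ha b) atImInfty atImInfty := by
  rw [atImInfty, tendsto_comap_iff]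
  have : UpperHalfPlane.im ∘ affineH a ha b = fun τ => a * τ.im := by
    ext τ
    rw [Function.comp_apply, ← coe_im, coe_affineH]
    simp
  rw [this]
  exact tendsto_comap.const_mul_atTop ha

noncomputable def dilate : ℍ → ℍ := affineH 2 two_pos 0
noncomputable def halve : ℍ → ℍ := affineH (1 / 2) one_half_pos 0
noncomputable def halveShift : ℍ → ℍ := affineH (1 / 2) one_half_pos (1 / 2)

theorem coe_S_smul (z : ℍ) : ((ModularGroup.S • z : ℍ) : ℂ) = -(z : ℂ)⁻¹ := by
  rw [modular_S_smul]
  simp [inv_neg]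

theorem coe_T_smul (z : ℍ) : ((ModularGroup.T • z : ℍ) : ℂ) = z + 1 := by
  rw [modular_T_smul]
  simp [add_comm]

theorem dilate_S (z : ℍ) : dilate (ModularGroup.S • z) = ModularGroup.S • halve z := by
  ext1
  simp only [coe_S_smul, dilate, halve, coe_affineH]
  push_cast
  rw [add_zero, add_zero, mul_inv]
  ring

theorem halve_S (z : ℍ) : halve (ModularGroup.S • z) = ModularGroup.S • dilate z := by
  ext1
  have := z.ne_zero
  simp only [coe_S_smul, dilate, halve, coe_affineH]
  push_cast
  field_simp
  ring

theorem dilate_T (z : ℍ) :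
    dilate (ModularGroup.T • z) = ModularGroup.T • ModularGroup.T • dilate z := by
  ext1
  simp only [coe_T_smul, dilate, coe_affineH]
  push_cast
  ring

theorem halve_T (z : ℍ) : halve (ModularGroup.T • z) = halveShift z := by
  ext1
  simp only [coe_T_smul, halve, halveShift, coe_affineH]
  push_cast
  ring

theorem halveShift_T (z : ℍ) : halveShift (ModularGroup.T • z) = ModularGroup.T • halve z := by
  ext1
  simp only [coe_T_smul, halve, halveShift, coe_affineH]
  push_cast
  ring

theorem E2_halveShift_S (z : ℍ) :
    E2 (halveShift (ModularGroup.S • z)) =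
      (z : ℂ) ^ 2 * E2 (halveShift z) + 12 / (π * Complex.I) * z := by
  let γ : SL(2, ℤ) := ⟨!![1, -1; 2, -1], by simp [Matrix.det_fin_two]⟩
  have hd : denom γ (halveShift z) = z := by
    rw [ModularGroup.denom_apply]
    simp [γ, halveShift, coe_affineH]
    ring
  have h : halveShift (ModularGroup.S • z) = γ • halveShift z := by
    ext1
    have := z.ne_zero
    have h2 : (γ 1 0 : ℝ) * (halveShift z : ℂ) + (γ 1 1 : ℝ) = z := by
      rw [← hd, ModularGroup.denom_apply]; simp
    rw [UpperHalfPlane.coe_specialLinearGroup_apply]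
    simp only [algebraMap_int_eq, eq_intCast] at h2 ⊢
    rw [h2]
    simp only [coe_S_smul, halveShift, coe_affineH, γ]
    simp
    field_simp
    ring
  rw [h, E2_SL_smul, hd]
  simp only [γ, Matrix.of_apply, Matrix.cons_val_zero,
    Matrix.cons_val_one, Int.cast_ofNat]
  ring

noncomputable def levelTwo : ℍ → ℂ := (2 : ℂ) • (E2 ∘ dilate) - E2
noncomputable def levelTwoS : ℍ → ℂ := (1 / 2 : ℂ) • (E2 ∘ halve) - E2
noncomputable def levelTwoST : ℍ → ℂ := (1 / 2 : ℂ) • (E2 ∘ halveShift) - E2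

theorem levelTwo_S (z : ℍ) : levelTwo (ModularGroup.S • z) = (z : ℂ) ^ 2 * levelTwoS z := by
  simp only [levelTwo, levelTwoS, Pi.sub_apply, Pi.smul_apply, Function.comp_apply, dilate_S,
    E2_S_smul, smul_eq_mul]
  simp only [halve, coe_affineH]
  push_cast
  ring

theorem levelTwoS_S (z : ℍ) : levelTwoS (ModularGroup.S • z) = (z : ℂ) ^ 2 * levelTwo z := by
  simp only [levelTwo, levelTwoS, Pi.sub_apply, Pi.smul_apply, Function.comp_apply, halve_S,
    E2_S_smul, smul_eq_mul]
  simp only [dilate, coe_affineH]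
  push_cast
  ring

theorem levelTwoST_S (z : ℍ) : levelTwoST (ModularGroup.S • z) = (z : ℂ) ^ 2 * levelTwoST z := by
  simp only [levelTwoST, Pi.sub_apply, Pi.smul_apply, Function.comp_apply, E2_halveShift_S,
    E2_S_smul, smul_eq_mul]
  ring

theorem levelTwo_T (z : ℍ) : levelTwo (ModularGroup.T • z) = levelTwo z := by
  simp only [levelTwo, Pi.sub_apply, Pi.smul_apply, Function.comp_apply, dilate_T, E2_T_smul]

theorem levelTwoS_T (z : ℍ) : levelTwoS (ModularGroup.T • z) = levelTwoST z := by
  simp only [levelTwoS, levelTwoST, Pi.sub_apply, Pi.smul_apply, Function.comp_apply, halve_T,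
    E2_T_smul]

theorem levelTwoST_T (z : ℍ) : levelTwoST (ModularGroup.T • z) = levelTwoS z := by
  simp only [levelTwoS, levelTwoST, Pi.sub_apply, Pi.smul_apply, Function.comp_apply, halveShift_T,
    E2_T_smul]

theorem mdifferentiable_levelTwo : MDiff levelTwo :=
  ((mdifferentiable_comp_affineH E2_mdifferentiable _ _ _).const_smul _).sub E2_mdifferentiable

theorem mdifferentiable_levelTwoS : MDiff levelTwoS :=
  ((mdifferentiable_comp_affineH E2_mdifferentiable _ _ _).const_smul _).sub E2_mdifferentiable

theorem mdifferentiable_levelTwoST : MDiff levelTwoST :=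
  ((mdifferentiable_comp_affineH E2_mdifferentiable _ _ _).const_smul _).sub E2_mdifferentiable

theorem tendsto_levelTwo : Tendsto levelTwo atImInfty (𝓝 1) := by
  have := ((tendsto_E2.comp (tendsto_affineH 2 two_pos 0)).const_smul (2 : ℂ)).sub tendsto_E2
  norm_num at this
  exact this

theorem tendsto_levelTwoS : Tendsto levelTwoS atImInfty (𝓝 (-1 / 2)) := by
  have := ((tendsto_E2.comp (tendsto_affineH (1 / 2) one_half_pos 0)).const_smul (1 / 2 : ℂ)).sub
    tendsto_E2
  rw [show (1 / 2 : ℂ) • (1 : ℂ) - 1 = -1 / 2 by norm_num] at this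
  exact this

theorem tendsto_levelTwoST : Tendsto levelTwoST atImInfty (𝓝 (-1 / 2)) := by
  have := ((tendsto_E2.comp (tendsto_affineH (1 / 2) one_half_pos (1 / 2))).const_smul
    (1 / 2 : ℂ)).sub tendsto_E2
  rw [show (1 / 2 : ℂ) • (1 : ℂ) - 1 = -1 / 2 by norm_num] at this
  exact this

theorem levelTwo_cubic : (4 : ℂ) • levelTwo ^ 3 - (3 : ℂ) • (fourE * levelTwo) = sixE := by
  have m1 := mdifferentiable_levelTwo
  have m2 := mdifferentiable_levelTwoS
  have m3 := mdifferentiable_levelTwoST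
  have t1 := tendsto_levelTwo
  have t2 := tendsto_levelTwoS
  have t3 := tendsto_levelTwoST
  have h1 : IsModular 2 (levelTwo + levelTwoS + levelTwoST) :=
    ⟨(m1.add m2).add m3, fun z => by
      simp only [Pi.add_apply, levelTwo_S, levelTwoS_S, levelTwoST_S]; ring, fun z => by
      simp only [Pi.add_apply, levelTwo_T, levelTwoS_T, levelTwoST_T]; ring⟩
  have h2 : IsModular 4 (levelTwo * levelTwoS + levelTwo * levelTwoST + levelTwoS * levelTwoST) :=
    ⟨((m1.mul m2).add (m1.mul m3)).add (m2.mul m3), fun z => by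
      simp only [Pi.add_apply, Pi.mul_apply, levelTwo_S, levelTwoS_S, levelTwoST_S]; ring, fun z => by
      simp only [Pi.add_apply, Pi.mul_apply, levelTwo_T, levelTwoS_T, levelTwoST_T]; ring⟩
  have h3 : IsModular 6 (levelTwo * levelTwoS * levelTwoST) :=
    ⟨(m1.mul m2).mul m3, fun z => by
      simp only [Pi.mul_apply, levelTwo_S, levelTwoS_S, levelTwoST_S]; ring, fun z => by
      simp only [Pi.mul_apply, levelTwo_T, levelTwoS_T, levelTwoST_T]; ring⟩
  have k1 := h1.eq_zero (by norm_num) (by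
    have := (t1.add t2).add t3
    norm_num at this
    exact this)
  have k2 := h2.eq_smul (c := -3 / 4) (by norm_num) isModular_fourE (by
    have := ((t1.mul t2).add (t1.mul t3)).add (t2.mul t3)
    norm_num at this
    rw [neg_div]
    exact this) tendsto_fourE
  have k3 := h3.eq_smul (c := 1 / 4) (by norm_num) isModular_sixE (by
    have := (t1.mul t2).mul t3
    norm_num at this
    exact this) tendsto_sixE
  ext z
  have k1 := congrFun k1 z
  have k2 := congrFun k2 z
  have k3 := congrFun k3 z
  simp only [Pi.add_apply, Pi.mul_apply, Pi.smul_apply, smul_eq_mul, Pi.zero_apply] at k1 k2 k3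
  simp only [Pi.sub_apply, Pi.smul_apply, Pi.pow_apply, Pi.mul_apply, smul_eq_mul]
  linear_combination 4 * levelTwo z ^ 2 * k1 - 4 * levelTwo z * k2 + 4 * k3

/-- The `q`-expansion of `2 E₂(2τ) - E₂(τ)`. -/
noncomputable def levelTwoSeries : ℂ⟦X⟧ :=
  (2 : ℂ) • expand 2 two_ne_zero e2Series - e2Series

theorem isQSeries_levelTwo : IsQSeries levelTwo levelTwoSeries :=
  ((isQSeries_E2.double (g := dilate) fun τ => by simp [dilate, coe_affineH]).smul 2).sub
    isQSeries_E2

theorem levelTwoSeries_cubic :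
    4 * levelTwoSeries ^ 3 - 3 * (e4Series * levelTwoSeries) = e6Series := by
  have h := ((isQSeries_levelTwo.pow 2).smul 4).sub
    ((isQSeries_fourE.mul isQSeries_levelTwo).smul 3)
  rw [levelTwo_cubic] at h
  rw [← h.unique isQSeries_sixE, ofNat_smul_series, ofNat_smul_series]

end

/-- The real part of `(√a + √b i) ^ 12`. -/
def rePowTwelve {S : Type*} [CommRing S] (a b : S) : S :=
  a ^ 6 - 66 * a ^ 5 * b + 495 * a ^ 4 * b ^ 2 - 924 * a ^ 3 * b ^ 3 + 495 * a ^ 2 * b ^ 4 -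
    66 * a * b ^ 5 + b ^ 6

/-- The bilinear expression obtained from `rePowTwelve` by letting `a` and `b` be the operators
`x ↦ L x` and `x ↦ M x`, acting on the factors `f` and `g`. -/
def bilinTwelve {S : Type*} [CommRing S] (L M : S → S) (f g : S) : S :=
  L^[6] f * g - 66 * (L^[5] f * M^[1] g) + 495 * (L^[4] f * M^[2] g) -
    924 * (L^[3] f * M^[3] g) + 495 * (L^[2] f * M^[4] g) - 66 * (L^[1] f * M^[5] g) +
    f * M^[6] g

set_option linter.unusedSimpArgs false

section

variable {K S : Type*} [CommRing K] [CommRing S] [Algebra K S] (δ : Derivation K S S)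

theorem bilinTwelve_level_one {P E Q R : S} (hP : δ P = P * (E - 1))
    (hE : δ E = 2 * E ^ 2 - 2 * Q) (hQ : δ Q = 8 * (E * Q) - 8 * R)
    (hR : δ R = 12 * (E * R) - 12 * Q ^ 2) :
    bilinTwelve (fun x => δ x + x) (fun x => δ x + x) P P =
      P ^ 2 * (255936 * Q ^ 3 - 256000 * R ^ 2) := by
  have nat_mul : ∀ (n : ℕ) [n.AtLeastTwo] (x : S), δ (OfNat.ofNat n * x) = OfNat.ofNat n * δ x := by
    intro n _ x
    rw [Derivation.leibniz, ← Nat.cast_ofNat (R := S) (n := n), Derivation.map_natCast]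
    simp
  have u1 : (fun x => δ x + x)^[1] P =
      P * (E) := by
    simp only [Function.iterate_one, hP]
    ring
  have u2 : (fun x => δ x + x)^[2] P =
      P * (3 * E ^ 2 - 2 * Q) := by
    rw [Function.iterate_succ_apply', u1]
    simp only [map_add, map_sub, nat_mul, Derivation.leibniz, Derivation.leibniz_pow,
      smul_eq_mul, nsmul_eq_mul, hP, hE, hQ, hR]
    ring
  have u3 : (fun x => δ x + x)^[3] P =
      P * (15 * E ^ 3 - 30 * E * Q + 16 * R) := by
    rw [Function.iterate_succ_apply', u2]
    simp only [map_add, map_sub, nat_mul, Derivation.leibniz, Derivation.leibniz_pow,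
      smul_eq_mul, nsmul_eq_mul, hP, hE, hQ, hR]
    ring
  have u4 : (fun x => δ x + x)^[4] P =
      P * (105 * E ^ 4 - 420 * E ^ 2 * Q + 448 * E * R - 132 * Q ^ 2) := by
    rw [Function.iterate_succ_apply', u3]
    simp only [map_add, map_sub, nat_mul, Derivation.leibniz, Derivation.leibniz_pow,
      smul_eq_mul, nsmul_eq_mul, hP, hE, hQ, hR]
    ring
  have u5 : (fun x => δ x + x)^[5] P =
      P * (945 * E ^ 5 - 6300 * E ^ 3 * Q + 10080 * E ^ 2 * R - 5940 * E * Q ^ 2 + 1216 * Q *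
      R) := by
    rw [Function.iterate_succ_apply', u4]
    simp only [map_add, map_sub, nat_mul, Derivation.leibniz, Derivation.leibniz_pow,
      smul_eq_mul, nsmul_eq_mul, hP, hE, hQ, hR]
    ring
  have u6 : (fun x => δ x + x)^[6] P =
      P * (10395 * E ^ 6 - 103950 * E ^ 4 * Q + 221760 * E ^ 3 * R - 196020 * E ^ 2 * Q ^ 2 +
      80256 * E * Q * R - 2712 * Q ^ 3 - 9728 * R ^ 2) := by
    rw [Function.iterate_succ_apply', u5]
    simp only [map_add, map_sub, nat_mul, Derivation.leibniz, Derivation.leibniz_pow,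
      smul_eq_mul, nsmul_eq_mul, hP, hE, hQ, hR]
    ring
  simp only [bilinTwelve, u1, u2, u3, u4, u5, u6]
  ring

theorem bilinTwelve_level_two {H f E A Q R : S} (hH : δ H = H * (E + A - 2))
    (hf : δ f = f * (E - A)) (hE : δ E = 2 * E ^ 2 - 2 * Q)
    (hA : δ A = 4 * (E * A) - 8 * A ^ 2 + 4 * Q) (hQ : δ Q = 8 * (E * Q) - 8 * R)
    (hR : 4 * A ^ 3 - 3 * (Q * A) = R) :
    bilinTwelve (fun x => δ x + 2 * x) (fun x => δ x) H f =
      f * H * (348096 * Q ^ 3 - 348032 * R ^ 2) := by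
  subst hR
  have nat_mul : ∀ (n : ℕ) [n.AtLeastTwo] (x : S), δ (OfNat.ofNat n * x) = OfNat.ofNat n * δ x := by
    intro n _ x
    rw [Derivation.leibniz, ← Nat.cast_ofNat (R := S) (n := n), Derivation.map_natCast]
    simp
  have v1 : (fun x => δ x + 2 * x)^[1] H =
      H * (E + A) := by
    simp only [Function.iterate_one, hH]
    ring
  have v2 : (fun x => δ x + 2 * x)^[2] H =
      H * (3 * E ^ 2 + 6 * E * A - 7 * A ^ 2 + 2 * Q) := by
    rw [Function.iterate_succ_apply', v1]
    simp only [map_add, map_sub, nat_mul, Derivation.leibniz, Derivation.leibniz_pow,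
      smul_eq_mul, nsmul_eq_mul, hH, hE, hA, hQ]
    ring
  have v3 : (fun x => δ x + 2 * x)^[3] H =
      H * (15 * E ^ 3 + 45 * E ^ 2 * A - 105 * E * A ^ 2 + 30 * E * Q + 41 * A ^ 3 - 18 * A *
      Q) := by
    rw [Function.iterate_succ_apply', v2]
    simp only [map_add, map_sub, nat_mul, Derivation.leibniz, Derivation.leibniz_pow,
      smul_eq_mul, nsmul_eq_mul, hH, hE, hA, hQ]
    ring
  have v4 : (fun x => δ x + 2 * x)^[4] H =
      H * (105 * E ^ 4 + 420 * E ^ 3 * A - 1470 * E ^ 2 * A ^ 2 + 420 * E ^ 2 * Q + 1148 * E *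
      A ^ 3 - 504 * E * A * Q - 367 * A ^ 4 + 396 * A ^ 2 * Q - 132 * Q ^ 2) := by
    rw [Function.iterate_succ_apply', v3]
    simp only [map_add, map_sub, nat_mul, Derivation.leibniz, Derivation.leibniz_pow,
      smul_eq_mul, nsmul_eq_mul, hH, hE, hA, hQ]
    ring
  have v5 : (fun x => δ x + 2 * x)^[5] H =
      H * (945 * E ^ 5 + 4725 * E ^ 4 * A - 22050 * E ^ 3 * A ^ 2 + 6300 * E ^ 3 * Q + 25830 *
      E ^ 2 * A ^ 3 - 11340 * E ^ 2 * A * Q - 16515 * E * A ^ 4 + 17820 * E * A ^ 2 * Q - 5940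
      * E * Q ^ 2 - 1295 * A ^ 5 + 3844 * A ^ 3 * Q - 2292 * A * Q ^ 2) := by
    rw [Function.iterate_succ_apply', v4]
    simp only [map_add, map_sub, nat_mul, Derivation.leibniz, Derivation.leibniz_pow,
      smul_eq_mul, nsmul_eq_mul, hH, hE, hA, hQ]
    ring
  have v6 : (fun x => δ x + 2 * x)^[6] H =
      H * (10395 * E ^ 6 + 62370 * E ^ 5 * A - 363825 * E ^ 4 * A ^ 2 + 103950 * E ^ 4 * Q +
      568260 * E ^ 3 * A ^ 3 - 249480 * E ^ 3 * A * Q - 544995 * E ^ 2 * A ^ 4 + 588060 * E ^ 2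
      * A ^ 2 * Q - 196020 * E ^ 2 * Q ^ 2 - 85470 * E * A ^ 5 + 253704 * E * A ^ 3 * Q -
      151272 * E * A * Q ^ 2 - 72503 * A ^ 6 + 157662 * A ^ 4 * Q - 83484 * A ^ 2 * Q ^ 2 +
      2712 * Q ^ 3) := by
    rw [Function.iterate_succ_apply', v5]
    simp only [map_add, map_sub, nat_mul, Derivation.leibniz, Derivation.leibniz_pow,
      smul_eq_mul, nsmul_eq_mul, hH, hE, hA, hQ]
    ring
  have w1 : (fun x => δ x)^[1] f =
      f * (E - A) := by
    simp only [Function.iterate_one, hf]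
  have w2 : (fun x => δ x)^[2] f =
      f * (3 * E ^ 2 - 6 * E * A + 9 * A ^ 2 - 6 * Q) := by
    rw [Function.iterate_succ_apply', w1]
    simp only [map_add, map_sub, nat_mul, Derivation.leibniz, Derivation.leibniz_pow,
      smul_eq_mul, nsmul_eq_mul, hf, hE, hA, hQ]
    ring
  have w3 : (fun x => δ x)^[3] f =
      f * (15 * E ^ 3 - 45 * E ^ 2 * A + 135 * E * A ^ 2 - 90 * E * Q + 39 * A ^ 3 - 54 * A *
      Q) := by
    rw [Function.iterate_succ_apply', w2]
    simp only [map_add, map_sub, nat_mul, Derivation.leibniz, Derivation.leibniz_pow,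
      smul_eq_mul, nsmul_eq_mul, hf, hE, hA, hQ]
    ring
  have w4 : (fun x => δ x)^[4] f =
      f * (105 * E ^ 4 - 420 * E ^ 3 * A + 1890 * E ^ 2 * A ^ 2 - 1260 * E ^ 2 * Q + 1092 * E *
      A ^ 3 - 1512 * E * A * Q + 753 * A ^ 4 - 612 * A ^ 2 * Q - 36 * Q ^ 2) := by
    rw [Function.iterate_succ_apply', w3]
    simp only [map_add, map_sub, nat_mul, Derivation.leibniz, Derivation.leibniz_pow,
      smul_eq_mul, nsmul_eq_mul, hf, hE, hA, hQ]
    ring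
  have w5 : (fun x => δ x)^[5] f =
      f * (945 * E ^ 5 - 4725 * E ^ 4 * A + 28350 * E ^ 3 * A ^ 2 - 18900 * E ^ 3 * Q + 24570 *
      E ^ 2 * A ^ 3 - 34020 * E ^ 2 * A * Q + 33885 * E * A ^ 4 - 27540 * E * A ^ 2 * Q - 1620
      * E * Q ^ 2 - 5265 * A ^ 5 + 7884 * A ^ 3 * Q - 3564 * A * Q ^ 2) := by
    rw [Function.iterate_succ_apply', w4]
    simp only [map_add, map_sub, nat_mul, Derivation.leibniz, Derivation.leibniz_pow,
      smul_eq_mul, nsmul_eq_mul, hf, hE, hA, hQ]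
    ring
  have w6 : (fun x => δ x)^[6] f =
      f * (10395 * E ^ 6 - 62370 * E ^ 5 * A + 467775 * E ^ 4 * A ^ 2 - 311850 * E ^ 4 * Q +
      540540 * E ^ 3 * A ^ 3 - 748440 * E ^ 3 * A * Q + 1118205 * E ^ 2 * A ^ 4 - 908820 * E ^
      2 * A ^ 2 * Q - 53460 * E ^ 2 * Q ^ 2 - 347490 * E * A ^ 5 + 520344 * E * A ^ 3 * Q -
      235224 * E * A * Q ^ 2 - 36423 * A ^ 6 + 47142 * A ^ 4 * Q + 10692 * A ^ 2 * Q ^ 2 -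
      11016 * Q ^ 3) := by
    rw [Function.iterate_succ_apply', w5]
    simp only [map_add, map_sub, nat_mul, Derivation.leibniz, Derivation.leibniz_pow,
      smul_eq_mul, nsmul_eq_mul, hf, hE, hA, hQ]
    ring
  simp only [bilinTwelve, v1, v2, v3, v4, v5, v6, w1, w2, w3, w4, w5, w6]
  ring

end

theorem eq_of_sq_add_mul_sq_eq_prime {p a b c e d : ℕ} (hp : p.Prime) (hd : 0 < d)
    (ha : 0 < a) (hb : 0 < b) (hc : 0 < c) (he : 0 < e)
    (h1 : p = a ^ 2 + d * b ^ 2) (h2 : p = c ^ 2 + d * e ^ 2) :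
    (a = c ∧ b = e) ∨ (d = 1 ∧ a = e ∧ b = c) := by
  have hpZ : Prime (p : ℤ) := Nat.prime_iff_prime_int.1 hp
  zify at h1 h2 ha hb hc he hd
  have key : (p : ℤ) ∣ (a * e - b * c) * (a * e + b * c) := ⟨e ^ 2 - b ^ 2, by
    linear_combination (-(e : ℤ) ^ 2) * h1 + b ^ 2 * h2⟩
  have hpp : (0 : ℤ) < p := by exact_mod_cast hp.pos
  rcases hpZ.dvd_or_dvd key with h | h
  · have e1 : (p : ℤ) ^ 2 = (a * c + d * b * e) ^ 2 + d * (a * e - b * c) ^ 2 := by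
      rw [pow_two]; nth_rw 1 [h1]; rw [h2]; ring
    obtain ⟨k, hk⟩ := h
    have hk0 : k = 0 := by
      by_contra hk0
      have : 1 ≤ k ^ 2 := Int.add_one_le_of_lt (sq_pos_of_ne_zero hk0)
      rw [hk] at e1
      have : 0 < (a * c + d * b * e : ℤ) := by positivity
      nlinarith [sq_nonneg (p : ℤ), mul_le_mul_of_nonneg_left this (sq_nonneg (p:ℤ))]
    left
    rw [hk0, mul_zero, sub_eq_zero] at hk
    have hbe : (b : ℤ) ^ 2 = e ^ 2 := by
      have : (p : ℤ) * (e ^ 2 - b ^ 2) = 0 := by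
        linear_combination ((e : ℤ) ^ 2) * h1 - b ^ 2 * h2 + (a * e + b * c) * hk
      rcases mul_eq_zero.1 this with h | h <;> linarith
    have hbe' : (b : ℤ) = e := by
      nlinarith
    have : (a : ℤ) = c := by
      have : (e : ℤ) * (a - c) = 0 := by rw [hbe'] at hk; linear_combination hk
      rcases mul_eq_zero.1 this with h | h <;> linarith
    exact ⟨by exact_mod_cast this, by exact_mod_cast hbe'⟩
  · have e1 : (p : ℤ) ^ 2 = (a * c - d * b * e) ^ 2 + d * (a * e + b * c) ^ 2 := by
      rw [pow_two]; nth_rw 1 [h1]; rw [h2]; ring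
    obtain ⟨k, hk⟩ := h
    have hk0 : 1 ≤ k := by
      have : 0 < (p : ℤ) * k := by rw [← hk]; positivity
      have := pos_of_mul_pos_right this hpp.le
      omega
    have hdk : (d : ℤ) * k ^ 2 ≤ 1 := by
      by_contra! hdk
      rw [hk] at e1
      have : (p : ℤ) ^ 2 * 2 ≤ p ^ 2 * (d * k ^ 2) := by gcongr; omega
      nlinarith [sq_nonneg (a * c - d * b * e : ℤ), pow_pos hpp 2]
    have hd1 : (d : ℤ) = 1 := by nlinarith
    have hk1 : k = 1 := by nlinarith
    rw [hk1, mul_one] at hk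
    rw [hd1, hk] at e1
    rw [hd1] at h1
    have hac : (a : ℤ) * c = b * e := by
      have : (a * c - 1 * b * e : ℤ) ^ 2 = 0 := by linarith
      have := pow_eq_zero_iff two_ne_zero |>.1 this
      linarith
    have hea : (p : ℤ) * (e - a) = 0 := by linear_combination e * h1 - b * hac + a * hk
    have hcb : (p : ℤ) * (c - b) = 0 := by linear_combination c * h1 + a * hac + b * hk
    right
    refine ⟨by exact_mod_cast hd1, ?_, ?_⟩
    · rcases mul_eq_zero.1 hea with h | h <;> omega
    · rcases mul_eq_zero.1 hcb with h | h <;> omega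

theorem exists_eq_sq_add_three_mul_sq {p : ℕ} (hp : p.Prime) (h3 : p % 3 = 1) :
    ∃ x y : ℕ, 0 < x ∧ 0 < y ∧ p = x ^ 2 + 3 * y ^ 2 := by
  have := Fact.mk hp
  have hsq : ∃ s : ZMod p, s ^ 2 = -3 := by
    obtain ⟨w, hw⟩ := exists_prime_orderOf_dvd_card (G := (ZMod p)ˣ) 3
      (by rw [ZMod.card_units]; omega)
    have hw3 : (w : ZMod p) ^ 3 = 1 := by
      have := pow_orderOf_eq_one w
      rw [hw] at this
      rw [← Units.val_pow_eq_pow_val, this, Units.val_one]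
    have hw1 : (w : ZMod p) - 1 ≠ 0 := by
      intro h
      rw [sub_eq_zero, Units.val_eq_one] at h
      simp [h] at hw
    refine ⟨2 * w + 1, mul_left_cancel₀ hw1 ?_⟩
    linear_combination 4 * hw3
  obtain ⟨s, hs⟩ := hsq
  have hns : ∀ k : ℕ, k ^ 2 ≠ p := fun k hk => by
    rw [← hk] at hp
    exact Nat.Prime.not_prime_pow le_rfl hp
  set k := p.sqrt with hk
  have hkp : k ^ 2 < p := lt_of_le_of_ne (Nat.sqrt_le' p) (hns k)
  have hcard : Fintype.card (ZMod p) < Fintype.card (Fin (k + 1) × Fin (k + 1)) := by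
    rw [ZMod.card, Fintype.card_prod, Fintype.card_fin]
    exact Nat.lt_succ_sqrt p
  obtain ⟨i, j, hij, h⟩ := Fintype.exists_ne_map_eq_of_card_lt
    (fun i : Fin (k + 1) × Fin (k + 1) => ((i.1 : ℕ) : ZMod p) - s * ((i.2 : ℕ) : ZMod p)) hcard
  obtain ⟨X, hX⟩ : ∃ X : ℤ, X = (i.1 : ℕ) - (j.1 : ℕ) := ⟨_, rfl⟩
  obtain ⟨Y, hY⟩ : ∃ Y : ℤ, Y = (i.2 : ℕ) - (j.2 : ℕ) := ⟨_, rfl⟩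
  have hXk : X ^ 2 ≤ k ^ 2 := by
    have h1 := i.1.is_lt
    have h2 := j.1.is_lt
    exact sq_le_sq' (by omega) (by omega)
  have hYk : Y ^ 2 ≤ k ^ 2 := by
    have h1 := i.2.is_lt
    have h2 := j.2.is_lt
    exact sq_le_sq' (by omega) (by omega)
  have hXY : X ≠ 0 ∨ Y ≠ 0 := by
    by_contra! h0
    exact hij (Prod.ext (Fin.ext (by omega)) (Fin.ext (by omega)))
  have hdvd : (p : ℤ) ∣ X ^ 2 + 3 * Y ^ 2 := by
    rw [← ZMod.intCast_zmod_eq_zero_iff_dvd, hX, hY]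
    push_cast
    linear_combination (((i.1 : ℕ) : ZMod p) - (j.1 : ℕ) + s * ((i.2 : ℕ) - (j.2 : ℕ))) * h +
      ((i.2 : ℕ) - (j.2 : ℕ) : ZMod p) ^ 2 * hs
  obtain ⟨m, hm⟩ := hdvd
  have hkp' : (k : ℤ) ^ 2 < p := by exact_mod_cast hkp
  have hm4 : m < 4 := by nlinarith
  have hm0 : 0 < m := by
    have : 0 < (p : ℤ) * m := by
      rw [← hm]
      rcases hXY with h | h <;> positivity
    exact pos_of_mul_pos_right this (by positivity)
  have fin : ∀ x y : ℤ, (p : ℤ) = x ^ 2 + 3 * y ^ 2 →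
      ∃ x y : ℕ, 0 < x ∧ 0 < y ∧ p = x ^ 2 + 3 * y ^ 2 := by
    intro x y h
    have h' : p = x.natAbs ^ 2 + 3 * y.natAbs ^ 2 := by zify; simpa using h
    refine ⟨x.natAbs, y.natAbs, ?_, ?_, h'⟩
    · refine Nat.pos_of_ne_zero fun h0 => ?_
      rw [h0] at h'
      omega
    · refine Nat.pos_of_ne_zero fun h0 => hns x.natAbs ?_
      rw [h0] at h'
      omega
  interval_cases m
  · exact fin X Y (by linarith)
  · exfalso
    have h2 : p % 2 = 1 := by
      rcases hp.eq_two_or_odd with h | h <;> omega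
    have h4 : (X ^ 2 + 3 * Y ^ 2) % 4 = 2 := by omega
    rcases Int.even_or_odd' X with ⟨x, hx | hx⟩ <;> rcases Int.even_or_odd' Y with ⟨y, hy | hy⟩ <;>
      rw [hx, hy] at h4 <;> ring_nf at h4 <;> omega
  · have h3X : (3 : ℤ) ∣ X := Int.prime_three.dvd_of_dvd_pow (n := 2) (by omega)
    obtain ⟨x, rfl⟩ := h3X
    exact fin Y x (by linarith)

theorem exists_eq_odd_sq_add_even_sq {p : ℕ} (hp : p.Prime) (h4 : p % 4 = 1) :
    ∃ u v : ℕ, 0 < u ∧ 0 < v ∧ Odd u ∧ Even v ∧ p = u ^ 2 + v ^ 2 := by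
  have := Fact.mk hp
  have hns : ∀ k : ℕ, k ^ 2 ≠ p := fun k hk => by
    rw [← hk] at hp
    exact Nat.Prime.not_prime_pow le_rfl hp
  have key : ∀ u v : ℕ, Odd u → u ^ 2 + v ^ 2 = p →
      ∃ u v : ℕ, 0 < u ∧ 0 < v ∧ Odd u ∧ Even v ∧ p = u ^ 2 + v ^ 2 := by
    intro u v hu h
    refine ⟨u, v, hu.pos, Nat.pos_of_ne_zero ?_, hu, ?_, h.symm⟩
    · rintro rfl
      exact hns u (by omega)
    · by_contra hv
      have hv := Nat.not_even_iff_odd.1 hv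
      have : Even (u ^ 2 + v ^ 2) := hu.pow.add_odd hv.pow
      rw [h, Nat.even_iff] at this
      omega
  obtain ⟨a, b, h⟩ := Nat.Prime.sq_add_sq (p := p) (by omega)
  rcases a.even_or_odd with ha | ha
  · refine key b a ?_ (by rw [← h, add_comm])
    by_contra hb
    have hb := Nat.not_odd_iff_even.1 hb
    have : Even (a ^ 2 + b ^ 2) :=
      (ha.pow_of_ne_zero two_ne_zero).add (hb.pow_of_ne_zero two_ne_zero)
    rw [h, Nat.even_iff] at this
    omega
  · exact key a b ha h

theorem existsUnique_odd_sq_add_even_sq {p : ℕ} (hp : p.Prime) (h4 : p % 4 = 1) :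
    ∃! uv : ℕ × ℕ, 0 < uv.1 ∧ 0 < uv.2 ∧ Odd uv.1 ∧ Even uv.2 ∧ p = uv.1 ^ 2 + uv.2 ^ 2 := by
  obtain ⟨u, v, hu, hv, hu', hv', h⟩ := exists_eq_odd_sq_add_even_sq hp h4
  refine ⟨(u, v), ⟨hu, hv, hu', hv', h⟩, ?_⟩
  rintro ⟨u₁, v₁⟩ ⟨hu₁, hv₁, hu₁', hv₁', h₁⟩
  rcases eq_of_sq_add_mul_sq_eq_prime (d := 1) hp one_pos hu₁ hv₁ hu hv (by simpa using h₁)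
    (by simpa using h) with ⟨rfl, rfl⟩ | ⟨-, rfl, rfl⟩
  · rfl
  · exact absurd hv' (Nat.not_even_iff_odd.2 hu₁')

theorem existsUnique_sq_add_three_mul_sq {p : ℕ} (hp : p.Prime) (h3 : p % 3 = 1) :
    ∃! xy : ℕ × ℕ, 0 < xy.1 ∧ 0 < xy.2 ∧ p = xy.1 ^ 2 + 3 * xy.2 ^ 2 := by
  obtain ⟨x, y, hx, hy, h⟩ := exists_eq_sq_add_three_mul_sq hp h3
  refine ⟨(x, y), ⟨hx, hy, h⟩, ?_⟩
  rintro ⟨x₁, y₁⟩ ⟨hx₁, hy₁, h₁⟩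
  rcases eq_of_sq_add_mul_sq_eq_prime hp three_pos hx₁ hy₁ hx hy h₁ h with ⟨rfl, rfl⟩ | ⟨h, -⟩
  · rfl
  · omega

section

open Complex Filter Derivative PowerSeries

/-- Coefficientwise eventual equality of a sequence of power series with a fixed series. -/
def CoeffLim (F : ℕ → ℂ⟦X⟧) (g : ℂ⟦X⟧) : Prop :=
  ∀ n, ∀ᶠ N in atTop, coeff n (F N) = coeff n g

namespace CoeffLim

variable {F G : ℕ → ℂ⟦X⟧} {f g : ℂ⟦X⟧}

theorem eventually_le (h : CoeffLim F f) (n : ℕ) :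
    ∀ᶠ N in atTop, ∀ m ≤ n, coeff m (F N) = coeff m f := by
  have := (Finset.range (n + 1)).eventually_all (l := atTop)
    (p := fun m N => coeff m (F N) = coeff m f)
  filter_upwards [this.2 fun m _ => h m] with N hN m hm
  exact hN m (Finset.mem_range.2 (by omega))

theorem mul (hF : CoeffLim F f) (hG : CoeffLim G g) :
    CoeffLim (fun N => F N * G N) (f * g) := by
  intro n
  filter_upwards [hF.eventually_le n, hG.eventually_le n] with N h1 h2
  rw [coeff_mul, coeff_mul]
  refine Finset.sum_congr rfl fun ij hij => ?_
  have := Finset.HasAntidiagonal.mem_antidiagonal.1 hij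
  rw [h1 _ (by omega), h2 _ (by omega)]

theorem unique (hF : CoeffLim F f) (hG : CoeffLim F g) : f = g := by
  ext n
  obtain ⟨N, h1, h2⟩ := ((hF n).and (hG n)).exists
  rw [← h1, h2]

theorem eulerD (hF : CoeffLim F f) : CoeffLim (fun N => eulerD (F N)) (eulerD f) := by
  intro n
  filter_upwards [hF n] with N h
  rw [coeff_eulerD, coeff_eulerD, h]

theorem expand (hF : CoeffLim F f) {p : ℕ} (hp : p ≠ 0) :
    CoeffLim (fun N => expand p hp (F N)) (expand p hp f) := by
  intro n
  filter_upwards [hF (n / p)] with N h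
  simp only [coeff_expand, h]

end CoeffLim

/-- The partial products of `∏ (1 - X ^ m)`. -/
noncomputable def eulerProd (N : ℕ) : ℂ⟦X⟧ := ∏ m ∈ Finset.range N, (1 - X ^ (m + 1))

theorem coeffLim_eulerProd : CoeffLim eulerProd (pentagonalSeries ℂ) := by
  intro n
  obtain ⟨s, hs⟩ := eventually_atTop.1 (coeff_prod_one_sub_X_pow_eventually_eq (R := ℂ) n)
  filter_upwards [tendsto_finset_range.eventually_ge_atTop s] with N hN
  exact hs _ hN

/-- The Lambert series `∑ d X ^ (d k)`, summed over `k ≥ 1`. -/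
noncomputable def lambertTerm (d : ℕ) : ℂ⟦X⟧ :=
  PowerSeries.mk fun n => if d ∣ n ∧ n ≠ 0 then (d : ℂ) else 0

theorem one_sub_X_pow_mul_lambertTerm {d : ℕ} (hd : d ≠ 0) :
    (1 - X ^ d) * lambertTerm d = (d : ℂ) • X ^ d := by
  ext n
  rw [sub_mul, one_mul, map_sub, coeff_X_pow_mul', coeff_smul, coeff_X_pow]
  simp only [lambertTerm, coeff_mk]
  rcases lt_trichotomy n d with h | rfl | h
  · rw [if_neg (by rintro ⟨h1, h2⟩; exact h2 (Nat.eq_zero_of_dvd_of_lt h1 h)), if_neg (by omega),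
      if_neg (by omega)]
    simp
  · simp [hd]
  · have : d ∣ n - d ↔ d ∣ n := (Nat.dvd_sub_iff_left h.le dvd_rfl)
    rw [if_pos h.le, if_neg (show n ≠ d by omega)]
    simp only [this, ne_eq, show n ≠ 0 by omega, show n - d ≠ 0 by omega, not_false_eq_true,
      and_true, sub_self, smul_zero]

theorem eulerD_eulerProd (N : ℕ) :
    eulerD (eulerProd N) = -(eulerProd N * ∑ m ∈ Finset.range N, lambertTerm (m + 1)) := by
  induction N with
  | zero => simp [eulerProd]
  | succ N ih =>
    have hX : eulerD (1 - X ^ (N + 1)) = -((1 - X ^ (N + 1)) * lambertTerm (N + 1)) := by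
      rw [one_sub_X_pow_mul_lambertTerm N.succ_ne_zero]
      ext n
      rw [coeff_eulerD, map_sub, map_neg, coeff_smul, coeff_X_pow, coeff_one]
      split_ifs <;> simp_all
    have : eulerProd (N + 1) = eulerProd N * (1 - X ^ (N + 1)) := Finset.prod_range_succ _ _
    rw [this, Derivation.leibniz, ih, hX, Finset.sum_range_succ, smul_eq_mul, smul_eq_mul]
    ring

theorem coeffLim_sum_lambertTerm :
    CoeffLim (fun N => ∑ m ∈ Finset.range N, lambertTerm (m + 1))
      (PowerSeries.mk fun n => (ArithmeticFunction.sigma 1 n : ℂ)) := by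
  intro n
  filter_upwards [eventually_ge_atTop n] with N hN
  simp only [map_sum, lambertTerm, coeff_mk]
  rcases eq_or_ne n 0 with rfl | hn
  · simp
  rw [ArithmeticFunction.sigma_one_apply, Nat.cast_sum, ← Finset.sum_filter]
  refine Finset.sum_bij (fun m _ => m + 1) ?_ ?_ ?_ ?_
  · intro m hm
    simp_all
  · intro m _ m' _ h
    omega
  · intro d hd
    have hd' := Nat.mem_divisors.1 hd
    have hle := Nat.le_of_dvd (Nat.pos_of_ne_zero hn) hd'.1
    have hpos := Nat.pos_of_dvd_of_pos hd'.1 (Nat.pos_of_ne_zero hn)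
    refine ⟨d - 1, ?_, by omega⟩
    have : d - 1 + 1 = d := by omega
    simp only [Finset.mem_filter, Finset.mem_range, this]
    exact ⟨by omega, hd'.1, hn⟩
  · intros
    rfl

theorem eulerD_pentagonalSeries :
    24 * eulerD (pentagonalSeries ℂ) = pentagonalSeries ℂ * (e2Series - 1) := by
  have h1 := coeffLim_eulerProd.eulerD
  have h2 := coeffLim_eulerProd.mul coeffLim_sum_lambertTerm
  have h3 : eulerD (pentagonalSeries ℂ) = -(pentagonalSeries ℂ *
      PowerSeries.mk fun n => (ArithmeticFunction.sigma 1 n : ℂ)) := by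
    refine h1.unique fun n => ?_
    filter_upwards [h2 n] with N h
    rw [eulerD_eulerProd, map_neg, map_neg, h]
  have h4 : e2Series = 1 - 24 * PowerSeries.mk fun n => (ArithmeticFunction.sigma 1 n : ℂ) := by
    ext n
    rw [map_sub, ← ofNat_smul_series, coeff_smul, coeff_one, e2Series, coeff_mk, coeff_mk]
    split_ifs with h <;> simp [h]
  rw [h3, h4]
  ring

section

variable {S : Type*} [CommRing S] (q : S)

/-- A finite form of Gauss's identity `∑ (-1) ^ s q ^ (s ^ 2) = ∏ (1 - q ^ m) / (1 + q ^ m)`. -/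
theorem prod_mul_sum_neg_one_pow_sq (n : ℕ) :
    (∏ m ∈ Finset.range n, (1 + q ^ (m + 1))) *
        (1 + 2 * ∑ s ∈ Finset.range n, (-1) ^ (s + 1) * q ^ (s + 1) ^ 2) =
      (∏ m ∈ Finset.range n, (1 - q ^ (m + 1))) +
        2 * ∑ s ∈ Finset.range n, (-1) ^ (s + 1) * q ^ ((s + 1) * (n + 1)) *
          (∏ m ∈ Finset.Ico (s + 1) n, (1 - q ^ (m + 1))) *
            ∏ m ∈ Finset.range s, (1 + q ^ (m + 1)) := by
  induction n with
  | zero => simp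
  | succ n ih =>
    set U := ∏ m ∈ Finset.range n, (1 - q ^ (m + 1)) with hU
    set V : ℕ → S := fun n => ∏ m ∈ Finset.range n, (1 + q ^ (m + 1)) with hV
    set W : ℕ → ℕ → S := fun n s => ∏ m ∈ Finset.Ico s n, (1 - q ^ (m + 1)) with hW
    have hV' : ∀ n, V (n + 1) = V n * (1 + q ^ (n + 1)) := fun n => Finset.prod_range_succ _ _
    have hW' : ∀ s ≤ n, W (n + 1) s = W n s * (1 - q ^ (n + 1)) := fun s hs =>
      Finset.prod_Ico_succ_top hs _
    have hW'' : ∀ s < n, W n s = (1 - q ^ (s + 1)) * W n (s + 1) := fun s hs =>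
      Finset.prod_eq_prod_Ico_succ_bot hs _
    have hWself : W n n = 1 := by simp [hW]
    have hW0 : W n 0 = U := by simp [hW, hU]
    change V n * _ = U + 2 * ∑ s ∈ Finset.range n, _ * W n (s + 1) * V s at ih
    change V (n + 1) * _ = _ + 2 * ∑ s ∈ Finset.range (n + 1), _ * W (n + 1) (s + 1) * V s
    have telescope : ∀ k ≤ n,
        ∑ s ∈ Finset.range k,
          (-1) ^ (s + 1) * q ^ ((s + 1) * (n + 1 + 1)) * W (n + 1) (s + 1) * V s =
        (1 + q ^ (n + 1)) *
          ∑ s ∈ Finset.range k, (-1) ^ (s + 1) * q ^ ((s + 1) * (n + 1)) * W n (s + 1) * V s +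
        q ^ (n + 1) * U - (-1) ^ k * q ^ ((k + 1) * (n + 1)) * W n k * V k := by
      intro k hk
      induction k with
      | zero => simp [hV, hW0]
      | succ k ihk =>
        rw [Finset.sum_range_succ, Finset.sum_range_succ, ihk (by omega), hW' _ hk,
          hW'' k (by omega), hV' k]
        ring
    rw [Finset.sum_range_succ, Finset.sum_range_succ, Finset.prod_range_succ, telescope n le_rfl,
      hWself, hV', ← hU]
    have hWs : W (n + 1) (n + 1) = 1 := by simp [hW]
    rw [hWs]
    linear_combination (1 + q ^ (n + 1)) * ih
end

/-- The theta series `∑ (-1) ^ z X ^ (z ^ 2)`, summed over the integers. -/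
noncomputable def thetaSeries : ℂ⟦X⟧ :=
  PowerSeries.mk fun n => if n = 0 then 1 else if IsSquare n then 2 * (-1) ^ n else 0

theorem coeffLim_thetaSeries :
    CoeffLim (fun N => 1 + 2 * ∑ s ∈ Finset.range N, (-1) ^ (s + 1) * X ^ (s + 1) ^ 2)
      thetaSeries := by
  intro n
  filter_upwards [eventually_ge_atTop n] with N hN
  have h : ∀ s, coeff n ((-1) ^ (s + 1) * X ^ (s + 1) ^ 2 : ℂ⟦X⟧) =
      if n = (s + 1) ^ 2 then (-1) ^ (s + 1) else 0 := by
    intro s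
    have : ((-1) ^ (s + 1) : ℂ⟦X⟧) = C ((-1) ^ (s + 1)) := by simp
    rw [this, coeff_C_mul, coeff_X_pow, mul_ite, mul_one, mul_zero]
  rw [map_add, ← ofNat_smul_series, coeff_smul, map_sum, Finset.sum_congr rfl fun s _ => h s,
    thetaSeries, coeff_mk, coeff_one]
  rcases eq_or_ne n 0 with rfl | hn
  · rw [Finset.sum_eq_zero fun s _ => if_neg (pow_pos s.succ_pos 2).ne]
    simp
  by_cases hs : IsSquare n
  · obtain ⟨k, rfl⟩ := hs
    have hk : k ≠ 0 := by rintro rfl; exact hn rfl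
    obtain ⟨k, rfl⟩ := Nat.exists_eq_succ_of_ne_zero hk
    rw [Finset.sum_eq_single_of_mem k]
    · have : (-1 : ℂ) ^ ((k + 1) * (k + 1)) = (-1) ^ (k + 1) := by
        rcases (k + 1).even_or_odd with h | h
        · rw [h.neg_one_pow, (h.mul_left _).neg_one_pow]
        · rw [h.neg_one_pow, (h.mul h).neg_one_pow]
      simp [pow_two, this]
    · rw [Finset.mem_range]
      nlinarith
    · intro s _ hsk
      rw [if_neg]
      intro h
      apply hsk
      nlinarith
  · rw [Finset.sum_eq_zero fun s _ => if_neg fun h => hs ⟨s + 1, by rw [h, pow_two]⟩]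
    simp [hn, hs]

theorem expand_eulerProd (N : ℕ) :
    expand 2 two_ne_zero (eulerProd N) =
      eulerProd N * ∏ m ∈ Finset.range N, (1 + X ^ (m + 1)) := by
  rw [eulerProd, map_prod, ← Finset.prod_mul_distrib]
  refine Finset.prod_congr rfl fun m _ => ?_
  rw [map_sub, map_one, map_pow, expand_X]
  ring

theorem thetaSeries_mul_expand :
    expand 2 two_ne_zero (pentagonalSeries ℂ) * thetaSeries = pentagonalSeries ℂ ^ 2 := by
  refine ((coeffLim_eulerProd.expand two_ne_zero).mul coeffLim_thetaSeries).unique fun n => ?_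
  rw [pow_two]
  filter_upwards [(coeffLim_eulerProd.mul coeffLim_eulerProd) n, eventually_ge_atTop n] with N h hN
  rw [← h, expand_eulerProd, mul_assoc, prod_mul_sum_neg_one_pow_sq, ← eulerProd, mul_add, map_add,
    add_eq_left]
  refine X_pow_dvd_iff.1 ?_ n (Nat.lt_succ_of_le hN)
  refine Dvd.dvd.mul_left (Dvd.dvd.mul_left (Finset.dvd_sum fun s _ => ?_) _) _
  refine Dvd.dvd.mul_right (Dvd.dvd.mul_right (Dvd.dvd.mul_left (pow_dvd_pow _ ?_) _) _) _
  nlinarith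

theorem eulerD_ofNat (n : ℕ) [n.AtLeastTwo] : eulerD (ofNat(n) : ℂ⟦X⟧) = 0 :=
  eulerD.map_natCast n

theorem coeff_ofNat_mul' (n : ℕ) [n.AtLeastTwo] (k : ℕ) (x : ℂ⟦X⟧) :
    coeff k (ofNat(n) * x) = ofNat(n) * coeff k x := by
  change coeff k (OfNat.ofNat n * x) = OfNat.ofNat n * coeff k x
  rw [← ofNat_smul_series, coeff_smul, smul_eq_mul]

theorem constantCoeff_levelTwoSeries : constantCoeff levelTwoSeries = 1 := by
  rw [← coeff_zero_eq_constantCoeff_apply, levelTwoSeries, map_sub, coeff_smul,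
    coeff_expand, if_pos (dvd_zero _), Nat.zero_div, coeff_zero_e2Series]
  norm_num

theorem eulerD_levelTwoSeries :
    6 * eulerD levelTwoSeries =
      e2Series * levelTwoSeries - 2 * levelTwoSeries ^ 2 + e4Series := by
  have hc := levelTwoSeries_cubic
  have h1 := congrArg eulerD hc
  simp only [map_sub, eulerD_ofNat, Derivation.leibniz, Derivation.leibniz_pow, smul_eq_mul,
    nsmul_eq_mul] at h1
  have h0 : 12 * levelTwoSeries ^ 2 - 3 * e4Series ≠ 0 := by
    intro h
    have := congrArg (coeff 0) h
    rw [map_sub, coeff_ofNat_mul', coeff_ofNat_mul'] at this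
    have h4 := coeff_zero_e4Series
    rw [coeff_zero_eq_constantCoeff_apply] at h4
    norm_num [constantCoeff_levelTwoSeries, h4] at this
  refine mul_left_cancel₀ h0 ?_
  push_cast at h1
  linear_combination 6 * h1 + 3 * eulerD_e6Series + 6 * levelTwoSeries * eulerD_e4Series -
    3 * e2Series * hc + 6 * levelTwoSeries * hc

theorem eulerD_expand_two (g : ℂ⟦X⟧) :
    eulerD (expand 2 two_ne_zero g) = 2 * expand 2 two_ne_zero (eulerD g) := by
  ext n
  rw [← ofNat_smul_series, coeff_smul, coeff_eulerD, coeff_expand, coeff_expand]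
  split_ifs with h
  · obtain ⟨k, rfl⟩ := h
    rw [Nat.mul_div_cancel_left _ two_pos, coeff_eulerD]
    push_cast
    rw [smul_eq_mul, mul_assoc]
  · simp

theorem eulerD_expand_pentagonalSeries :
    24 * eulerD (expand 2 two_ne_zero (pentagonalSeries ℂ)) =
      expand 2 two_ne_zero (pentagonalSeries ℂ) * (e2Series + levelTwoSeries - 2) := by
  have h := congrArg (expand 2 two_ne_zero) eulerD_pentagonalSeries
  rw [map_mul, map_mul, map_sub, map_one, map_ofNat] at h
  rw [eulerD_expand_two, levelTwoSeries, ofNat_smul_series]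
  linear_combination 2 * h

theorem eulerD_thetaSeries :
    24 * eulerD thetaSeries = thetaSeries * (e2Series - levelTwoSeries) := by
  have h := thetaSeries_mul_expand
  have h1 := congrArg eulerD h
  simp only [Derivation.leibniz, Derivation.leibniz_pow, smul_eq_mul, nsmul_eq_mul] at h1
  have h0 : expand 2 two_ne_zero (pentagonalSeries ℂ) ≠ 0 := by
    intro h
    have := congrArg (coeff 0) h
    have h2 := coeff_pentagonalSeries_pentagonal ℂ 0
    simp [coeff_expand, pentagonal] at this h2
    simp [this] at h2
  refine mul_left_cancel₀ h0 ?_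
  push_cast at h1
  linear_combination 24 * h1 - thetaSeries * eulerD_expand_pentagonalSeries +
    2 * pentagonalSeries ℂ * eulerD_pentagonalSeries - 2 * (e2Series - 1) * h

theorem eq_of_eulerD_eq_mul {Y Z g : ℂ⟦X⟧} (hY : eulerD Y = g * Y) (hZ : eulerD Z = g * Z)
    (hg : coeff 0 g = 1) (h1 : coeff 1 Y = coeff 1 Z) : Y = Z := by
  rw [← sub_eq_zero]
  have hW : eulerD (Y - Z) = g * (Y - Z) := by rw [map_sub, hY, hZ, mul_sub]
  have h1' : coeff 1 (Y - Z) = 0 := by rw [map_sub, h1, sub_self]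
  generalize Y - Z = W at hW h1'
  ext n
  rw [map_zero]
  induction n using Nat.strong_induction_on with
  | _ n ih =>
    rcases eq_or_ne n 1 with rfl | hn
    · exact h1'
    have h := congrArg (coeff n) hW
    rw [coeff_eulerD, coeff_mul, Finset.sum_eq_single_of_mem (0, n) (by simp), hg, one_mul] at h
    · have : ((n : ℂ) - 1) * coeff n W = 0 := by rw [sub_mul, h, one_mul, sub_self]
      refine (mul_eq_zero.1 this).resolve_left fun h => hn ?_
      exact_mod_cast sub_eq_zero.1 h
    · intro ij hij hne
      have := Finset.HasAntidiagonal.mem_antidiagonal.1 hij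
      rw [ih ij.2, mul_zero]
      by_contra h
      exact hne (Prod.ext (by simp; omega) (by simp; omega))

theorem discriminant_eq :
    1728 * (X * pentagonalSeries ℂ ^ 24) = e4Series ^ 3 - e6Series ^ 2 := by
  refine eq_of_eulerD_eq_mul (g := e2Series) ?_ ?_ coeff_zero_e2Series ?_
  · have hX : eulerD X = X := by
      ext n
      rw [coeff_eulerD, coeff_X]
      split_ifs with h <;> simp [h]
    simp only [eulerD_ofNat, Derivation.leibniz, Derivation.leibniz_pow, smul_eq_mul,
      nsmul_eq_mul, hX]
    push_cast
    linear_combination 1728 * X * pentagonalSeries ℂ ^ 23 * eulerD_pentagonalSeries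
  · simp only [map_sub, Derivation.leibniz_pow, smul_eq_mul, nsmul_eq_mul]
    push_cast
    linear_combination e4Series ^ 2 * eulerD_e4Series - e6Series * eulerD_e6Series
  · have h2 : coeff 1 e2Series = -24 := by simp [e2Series]
    have c2 := coeff_zero_e2Series
    have c4 := coeff_zero_e4Series
    have c6 := coeff_zero_e6Series
    rw [coeff_zero_eq_constantCoeff_apply] at c2 c4 c6
    have h4 : coeff 1 e4Series = 240 := by
      have := congrArg (coeff 1) eulerD_e2Series
      simp only [coeff_ofNat_mul', coeff_eulerD, map_sub, coeff_one_pow, c2, h2] at this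
      norm_num at this
      linear_combination this
    have h6 : coeff 1 e6Series = -504 := by
      have := congrArg (coeff 1) eulerD_e4Series
      simp only [map_sub, coeff_ofNat_mul', coeff_eulerD, coeff_one_mul e2Series, c2, c4,
        h2, h4] at this
      norm_num at this
      linear_combination this
    have hP := coeff_pentagonalSeries_pentagonal ℂ 0
    simp [pentagonal] at hP
    rw [coeff_ofNat_mul']
    simp [coeff_one_pow, c4, c6, h4, h6, hP]
    norm_num

theorem coeff_iterate {L : ℂ⟦X⟧ → ℂ⟦X⟧} {c : ℕ → ℂ} (hL : ∀ x n, coeff n (L x) = c n * coeff n x)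
    (k : ℕ) (x : ℂ⟦X⟧) (n : ℕ) : coeff n (L^[k] x) = c n ^ k * coeff n x := by
  induction k with
  | zero => simp
  | succ k ih => rw [Function.iterate_succ_apply', hL, ih, pow_succ, ← mul_assoc, mul_comm (c n)]

theorem coeff_bilinTwelve {L M : ℂ⟦X⟧ → ℂ⟦X⟧} {c d : ℕ → ℂ}
    (hL : ∀ x n, coeff n (L x) = c n * coeff n x) (hM : ∀ x n, coeff n (M x) = d n * coeff n x)
    (f g : ℂ⟦X⟧) (N : ℕ) :
    coeff N (bilinTwelve L M f g) = ∑ ij ∈ Finset.HasAntidiagonal.antidiagonal N,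
      rePowTwelve (c ij.1) (d ij.2) * (coeff ij.1 f * coeff ij.2 g) := by
  simp only [bilinTwelve, map_add, map_sub, coeff_ofNat_mul']
  simp only [coeff_mul, coeff_iterate hL, coeff_iterate hM, Finset.mul_sum,
    ← Finset.sum_add_distrib, ← Finset.sum_sub_distrib]
  refine Finset.sum_congr rfl fun ij _ => ?_
  rw [rePowTwelve]
  ring

theorem sum_rePowTwelve (N : ℕ) :
    (∑ ij ∈ Finset.HasAntidiagonal.antidiagonal N, rePowTwelve (24 * ij.1 + 1 : ℂ) (24 * ij.2 + 1) *
        (coeff ij.1 (pentagonalSeries ℂ) * coeff ij.2 (pentagonalSeries ℂ))) +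
      ∑ ij ∈ Finset.HasAntidiagonal.antidiagonal N, rePowTwelve (24 * ij.1 + 2 : ℂ) (24 * ij.2) *
        (coeff ij.1 (expand 2 two_ne_zero (pentagonalSeries ℂ)) * coeff ij.2 thetaSeries) =
      604032 * 1728 * coeff N (X * pentagonalSeries ℂ ^ 26) := by
  set δ : Derivation ℂ ℂ⟦X⟧ ℂ⟦X⟧ := (24 : ℂ) • eulerD with hδ
  have hδ' : ∀ x, δ x = 24 * eulerD x := fun x => by
    rw [hδ, Derivation.smul_apply, ofNat_smul_series]
  have hc : ∀ x n, coeff n (δ x) = 24 * n * coeff n x := fun x n => by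
    rw [hδ', coeff_ofNat_mul', coeff_eulerD, mul_assoc]
  have hE : δ e2Series = 2 * e2Series ^ 2 - 2 * e4Series := by
    rw [hδ']; linear_combination 2 * eulerD_e2Series
  have hQ : δ e4Series = 8 * (e2Series * e4Series) - 8 * e6Series := by
    rw [hδ']; linear_combination 8 * eulerD_e4Series
  have hR : δ e6Series = 12 * (e2Series * e6Series) - 12 * e4Series ^ 2 := by
    rw [hδ']; linear_combination 12 * eulerD_e6Series
  have hA : δ levelTwoSeries = 4 * (e2Series * levelTwoSeries) - 8 * levelTwoSeries ^ 2 +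
      4 * e4Series := by
    rw [hδ']; linear_combination 4 * eulerD_levelTwoSeries
  have h1 := bilinTwelve_level_one δ ((hδ' _).trans eulerD_pentagonalSeries) hE hQ hR
  have h2 := bilinTwelve_level_two δ ((hδ' _).trans eulerD_expand_pentagonalSeries)
    ((hδ' _).trans eulerD_thetaSeries) hE hA hQ levelTwoSeries_cubic
  have h3 := congrArg (coeff N) (congrArg₂ (· + ·) h1 h2)
  have hc' : ∀ x n, coeff n (δ x + x) = (24 * n + 1) * coeff n x := fun x n => by
    rw [map_add, hc]; ring
  have hc'' : ∀ x n, coeff n (δ x + 2 * x) = (24 * n + 2) * coeff n x := fun x n => by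
    rw [map_add, hc, coeff_ofNat_mul']; ring
  simp only [map_add, coeff_bilinTwelve hc' hc', coeff_bilinTwelve hc'' hc] at h3
  rw [h3, ← map_add, mul_assoc (604032 : ℂ), ← coeff_ofNat_mul' 1728, ← coeff_ofNat_mul' 604032]
  congr 1
  linear_combination -604032 * pentagonalSeries ℂ ^ 2 * discriminant_eq +
    (348096 * e4Series ^ 3 - 348032 * e6Series ^ 2) * thetaSeries_mul_expand

theorem CoeffLim.pow {F : ℕ → ℂ⟦X⟧} {f : ℂ⟦X⟧} (hF : CoeffLim F f) (k : ℕ) :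
    CoeffLim (fun N => F N ^ k) (f ^ k) := by
  induction k with
  | zero => simp [CoeffLim]
  | succ k ih => simpa only [pow_succ] using ih.mul hF


theorem intCast_eq_coeff_pentagonalSeries_pow {a : ℕ → ℤ} {k : ℕ}
    (ha : ∀ n N : ℕ, n ≤ N → a n =
      (((∏ m ∈ Finset.Icc 1 N, ((1 : Polynomial ℤ) - Polynomial.X ^ m)) ^ k).coeff n)) (n : ℕ) :
    (a n : ℂ) = coeff n (pentagonalSeries ℂ ^ k) := by
  obtain ⟨N, h, hN⟩ := ((coeffLim_eulerProd.pow k n).and (eventually_ge_atTop n)).exists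
  beta_reduce at h
  rw [← h, ha n N hN, ← eq_intCast (Int.castRingHom ℂ), ← Polynomial.coeff_map,
    ← Polynomial.coeff_coe]
  congr 1
  rw [Polynomial.map_pow, Polynomial.map_prod, Polynomial.coe_pow,
    ← Polynomial.coeToPowerSeries.ringHom_apply, map_prod, eulerProd, Finset.range_eq_Ico,
    Finset.prod_Ico_add' (fun m => (1 - X ^ m : ℂ⟦X⟧)), zero_add]
  refine congrArg (· ^ k) (Finset.prod_congr (by ext; simp) fun m _ => ?_)
  simp

theorem exists_of_coeff_pentagonalSeries_ne_zero {n : ℕ} (h : coeff n (pentagonalSeries ℂ) ≠ 0) :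
    ∃ k : ℤ, 24 * (n : ℤ) + 1 = (6 * k - 1) ^ 2 ∧
      coeff n (pentagonalSeries ℂ) = (k.negOnePow : ℤ) := by
  obtain ⟨k, rfl⟩ : n ∈ Set.range pentagonal := by
    by_contra hn
    exact h (coeff_pentagonalSeries_eq_zero ℂ hn)
  refine ⟨k, ?_, coeff_pentagonalSeries_pentagonal ℂ k⟩
  linear_combination 12 * two_mul_natCast_pentagonal k

theorem coeff_pentagonalSeries_ne_zero {n : ℕ} {k : ℤ} (h : 24 * (n : ℤ) + 1 = (6 * k - 1) ^ 2) :
    coeff n (pentagonalSeries ℂ) ≠ 0 := by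
  have : n = pentagonal k := by
    zify
    linarith [two_mul_natCast_pentagonal k]
  rw [this, coeff_pentagonalSeries_pentagonal]
  rcases Int.even_or_odd k with hk | hk <;> simp [hk]

section

variable {N p u v x y : ℕ}

/-- A representation of `2 p` by `(6 k - 1) ^ 2 + (6 l - 1) ^ 2` comes from `p = u ^ 2 + v ^ 2`. -/
theorem sq_cases_of_six_mul_sub_one (hp : p.Prime) (hu : 0 < u) (hv : 0 < v)
    (hu' : Odd u) (hv' : Even v) (h : p = u ^ 2 + v ^ 2) {k l : ℤ}
    (hkl : (6 * k - 1) ^ 2 + (6 * l - 1) ^ 2 = 2 * p) :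
    ((6 * k - 1) ^ 2 = ((u : ℤ) + v) ^ 2 ∧ (6 * l - 1) ^ 2 = ((u : ℤ) - v) ^ 2 ∨
      (6 * k - 1) ^ 2 = ((u : ℤ) - v) ^ 2 ∧ (6 * l - 1) ^ 2 = ((u : ℤ) + v) ^ 2) ∧
    ((k + l).negOnePow : ℤ) = (-1) ^ (if u % 3 = 0 then u else v) := by
  obtain ⟨s, hs⟩ : ∃ s, s = 3 * (k + l) - 1 := ⟨_, rfl⟩
  obtain ⟨t, ht⟩ : ∃ t, t = 3 * (k - l) := ⟨_, rfl⟩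
  have hst : (p : ℤ) = s ^ 2 + t ^ 2 := by rw [hs, ht]; linarith
  have hst' : p = s.natAbs ^ 2 + 1 * t.natAbs ^ 2 := by zify; simpa using hst
  have hs0 : 0 < s.natAbs := by omega
  have ht0 : 0 < t.natAbs := by
    refine Nat.pos_of_ne_zero fun h0 => ?_
    rw [h0] at hst'
    rw [hst'] at hp
    exact Nat.Prime.not_prime_pow (x := s.natAbs) le_rfl (by simpa using hp)
  have hk : 6 * k - 1 = s + t := by rw [hs, ht]; ring
  have hl : 6 * l - 1 = s - t := by rw [hs, ht]; ring
  have hodd := Nat.odd_iff.1 hu'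
  have heven := Nat.even_iff.1 hv'
  rw [hk, hl]
  rcases eq_of_sq_add_mul_sq_eq_prime hp one_pos hs0 ht0 hu hv hst' (by simpa using h) with
    ⟨h1, h2⟩ | ⟨-, h1, h2⟩
  · have h3 : (k + l).negOnePow = 1 := Int.negOnePow_even _ (by rw [Int.even_iff]; omega)
    rw [if_neg (by omega), hv'.neg_one_pow, h3]
    refine ⟨?_, rfl⟩
    rcases Int.natAbs_eq s with h | h <;> rcases Int.natAbs_eq t with h' | h' <;>
      rw [h, h', h1, h2] <;>
      first | exact Or.inl ⟨by ring1, by ring1⟩ | exact Or.inr ⟨by ring1, by ring1⟩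
  · have h3 : (k + l).negOnePow = -1 := Int.negOnePow_odd _ (by rw [Int.odd_iff]; omega)
    rw [if_pos (by omega), hu'.neg_one_pow, h3]
    refine ⟨?_, rfl⟩
    rcases Int.natAbs_eq s with h | h <;> rcases Int.natAbs_eq t with h' | h' <;>
      rw [h, h', h1, h2] <;>
      first | exact Or.inl ⟨by ring1, by ring1⟩ | exact Or.inr ⟨by ring1, by ring1⟩

theorem rePowTwelve_mul_pentagonal (hp : p.Prime) (hu : 0 < u) (hv : 0 < v)
    (hu' : Odd u) (hv' : Even v) (h : p = u ^ 2 + v ^ 2) {i j : ℕ} (hij : 12 * (i + j) + 1 = p) :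
    rePowTwelve (24 * i + 1 : ℂ) (24 * j + 1) *
        (coeff i (pentagonalSeries ℂ) * coeff j (pentagonalSeries ℂ)) =
      -64 * rePowTwelve (u ^ 2 : ℂ) (v ^ 2) *
        (coeff i (pentagonalSeries ℂ) * coeff j (pentagonalSeries ℂ)) := by
  rcases eq_or_ne (coeff i (pentagonalSeries ℂ)) 0 with hi | hi
  · simp [hi]
  rcases eq_or_ne (coeff j (pentagonalSeries ℂ)) 0 with hj | hj
  · simp [hj]
  congr 1
  obtain ⟨k, hk, -⟩ := exists_of_coeff_pentagonalSeries_ne_zero hi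
  obtain ⟨l, hl, -⟩ := exists_of_coeff_pentagonalSeries_ne_zero hj
  have hi' : (24 * i + 1 : ℂ) = ((24 * i + 1 : ℤ) : ℂ) := by push_cast; rfl
  have hj' : (24 * j + 1 : ℂ) = ((24 * j + 1 : ℤ) : ℂ) := by push_cast; rfl
  rw [hi', hj', hk, hl]
  rcases (sq_cases_of_six_mul_sub_one hp hu hv hu' hv' h (k := k) (l := l) (by
    rw [← hk, ← hl, ← hij]; push_cast; ring)).1 with ⟨h1, h2⟩ | ⟨h1, h2⟩ <;>
  · rw [h1, h2]
    push_cast [rePowTwelve]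
    ring

theorem coeff_pentagonalSeries_sq (hp : p.Prime) (hu : 0 < u) (hv : 0 < v)
    (hu' : Odd u) (hv' : Even v) (h : p = u ^ 2 + v ^ 2) (hN : 12 * N + 1 = p) :
    coeff N (pentagonalSeries ℂ ^ 2) = 2 * (-1) ^ (if u % 3 = 0 then u else v) := by
  have hmod : ∀ z : ℤ, z % 2 = 1 → z % 3 ≠ 0 →
      ∃ (i : ℕ) (k : ℤ), 24 * (i : ℤ) + 1 = (6 * k - 1) ^ 2 ∧ (6 * k - 1) ^ 2 = z ^ 2 := by
    intro z h2 h3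
    obtain ⟨k, hk⟩ : ∃ k, (6 * k - 1) ^ 2 = z ^ 2 := by
      rcases (by omega : z % 6 = 5 ∨ z % 6 = 1) with h | h
      · exact ⟨(z + 1) / 6, by rw [show 6 * ((z + 1) / 6) - 1 = z by omega]⟩
      · exact ⟨(1 - z) / 6, by rw [show 6 * ((1 - z) / 6) - 1 = -z by omega]; ring⟩
    refine ⟨pentagonal k, k, ?_, hk⟩
    linear_combination 12 * two_mul_natCast_pentagonal k
  have hodd := Nat.odd_iff.1 hu'
  have heven := Nat.even_iff.1 hv'
  have h3 : ((u : ℤ) + v) % 3 ≠ 0 ∧ ((u : ℤ) - v) % 3 ≠ 0 := by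
    have hp3 : (u ^ 2 + v ^ 2) % 3 = 1 := by omega
    rw [Nat.add_mod, Nat.pow_mod, Nat.pow_mod v] at hp3
    have : u % 3 < 3 := Nat.mod_lt _ (by norm_num)
    have : v % 3 < 3 := Nat.mod_lt _ (by norm_num)
    interval_cases hu3 : u % 3 <;> interval_cases hv3 : v % 3 <;> omega
  obtain ⟨i, k, hi, hi'⟩ := hmod _ (by omega) h3.1
  obtain ⟨j, l, hj, hj'⟩ := hmod _ (by omega) h3.2
  have hsum : i + j = N := by
    zify at h hN ⊢
    linarith
  have hne : i ≠ j := by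
    rintro rfl
    have : (u : ℤ) * v = 0 := by linarith
    have : 0 < (u : ℤ) * v := by positivity
    omega
  have hval : ∀ i j : ℕ, i + j = N → coeff i (pentagonalSeries ℂ) ≠ 0 →
      coeff j (pentagonalSeries ℂ) ≠ 0 →
      coeff i (pentagonalSeries ℂ) * coeff j (pentagonalSeries ℂ) =
          (-1) ^ (if u % 3 = 0 then u else v) ∧
        (24 * (i : ℤ) + 1 = (u + v) ^ 2 ∨ 24 * (j : ℤ) + 1 = (u + v) ^ 2) := by
    intro i j hij hi hj
    obtain ⟨k, hk, hki⟩ := exists_of_coeff_pentagonalSeries_ne_zero hi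
    obtain ⟨l, hl, hlj⟩ := exists_of_coeff_pentagonalSeries_ne_zero hj
    obtain ⟨h1, h2⟩ := sq_cases_of_six_mul_sub_one hp hu hv hu' hv' h (k := k) (l := l) (by
      rw [← hk, ← hl, ← hN, ← hij]; push_cast; ring)
    refine ⟨?_, ?_⟩
    · rw [hki, hlj, ← Int.cast_mul, ← Units.val_mul, ← Int.negOnePow_add, h2]
      push_cast
      rfl
    · rw [hk, hl]
      exact h1.imp And.left And.right
  have hci := coeff_pentagonalSeries_ne_zero hi
  have hcj := coeff_pentagonalSeries_ne_zero hj
  rw [pow_two, coeff_mul, ← Finset.sum_subset (s₁ := {(i, j), (j, i)}), Finset.sum_pair,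
    (hval i j hsum hci hcj).1, (hval j i (by omega) hcj hci).1, two_mul]
  · exact fun h => hne (congrArg Prod.fst h)
  · intro ab
    simp only [Finset.mem_insert, Finset.mem_singleton, Finset.HasAntidiagonal.mem_antidiagonal]
    rintro (rfl | rfl)
    · exact hsum
    · exact (add_comm _ _).trans hsum
  · rintro ⟨b, c⟩ hbc hne'
    rw [Finset.HasAntidiagonal.mem_antidiagonal] at hbc
    simp only [Finset.mem_insert, Finset.mem_singleton, Prod.mk.injEq] at hne' hbc
    by_contra h0
    have := (hval b c hbc (left_ne_zero_of_mul h0) (right_ne_zero_of_mul h0)).2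
    omega

theorem rePowTwelve_mul_theta (hp : p.Prime) (hx : 0 < x) (hy : 0 < y)
    (h : p = x ^ 2 + 3 * y ^ 2) {i j : ℕ} (hij : 12 * (i + j) + 1 = p) :
    rePowTwelve (24 * i + 2 : ℂ) (24 * j) *
        (coeff i (expand 2 two_ne_zero (pentagonalSeries ℂ)) * coeff j thetaSeries) =
      64 * rePowTwelve (x ^ 2 : ℂ) (3 * y ^ 2) *
        (coeff i (expand 2 two_ne_zero (pentagonalSeries ℂ)) * coeff j thetaSeries) := by
  rcases eq_or_ne (coeff i (expand 2 two_ne_zero (pentagonalSeries ℂ))) 0 with hi | hi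
  · simp [hi]
  rcases eq_or_ne (coeff j thetaSeries) 0 with hj | hj
  · simp [hj]
  congr 1
  rw [coeff_expand] at hi
  obtain ⟨m, rfl⟩ : 2 ∣ i := by
    by_contra h
    exact hi (if_neg h)
  rw [if_pos (dvd_mul_right _ _), Nat.mul_div_cancel_left _ two_pos] at hi
  obtain ⟨k, hk, -⟩ := exists_of_coeff_pentagonalSeries_ne_zero hi
  obtain ⟨z, rfl⟩ : IsSquare j := by
    by_contra h
    refine hj ?_
    rw [thetaSeries, coeff_mk, if_neg h, if_neg]
    rintro rfl
    exact h ⟨0, rfl⟩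
  have hrep : p = (6 * k - 1).natAbs ^ 2 + 3 * (2 * z) ^ 2 := by
    zify at hij ⊢
    rw [sq_abs, ← hk]
    linarith
  have hz : 0 < 2 * z := by
    refine Nat.pos_of_ne_zero fun h0 => ?_
    rw [h0] at hrep
    rw [hrep] at hp
    exact Nat.Prime.not_prime_pow (x := (6 * k - 1).natAbs) le_rfl (by simpa using hp)
  rcases eq_of_sq_add_mul_sq_eq_prime hp three_pos (by omega) hz hx hy hrep h with
    ⟨h1, h2⟩ | ⟨h, -⟩
  · have hx' : (24 * m + 1 : ℂ) = x ^ 2 := by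
      have : (24 * m + 1 : ℤ) = x ^ 2 := by rw [hk, ← h1]; simp
      exact_mod_cast this
    have hy' : (y : ℂ) = 2 * z := by rw [← h2]; push_cast; rfl
    rw [← hx', hy']
    push_cast [rePowTwelve]
    ring
  · omega

theorem coeff_pentagonalSeries_pow_mul (hp : p.Prime) (hu : 0 < u) (hv : 0 < v)
    (hu' : Odd u) (hv' : Even v) (h : p = u ^ 2 + v ^ 2) (hx : 0 < x) (hy : 0 < y)
    (h' : p = x ^ 2 + 3 * y ^ 2) (hN : 12 * (N + 1) + 1 = p) :
    8 * 1019304 * coeff N (pentagonalSeries ℂ ^ 26) =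
      (-1) ^ (if u % 3 = 0 then u else v) *
        (rePowTwelve (x ^ 2 : ℂ) (3 * y ^ 2) - rePowTwelve (u ^ 2 : ℂ) (v ^ 2)) := by
  have h1 := sum_rePowTwelve (N + 1)
  have h2 := coeff_pentagonalSeries_sq hp hu hv hu' hv' h hN
  have h3 := h2
  rw [← thetaSeries_mul_expand] at h3
  rw [pow_two] at h2
  rw [coeff_mul] at h2 h3
  rw [Finset.sum_congr rfl fun ij hij => rePowTwelve_mul_pentagonal hp hu hv hu' hv' h
      (by rw [Finset.HasAntidiagonal.mem_antidiagonal.1 hij, hN]), ← Finset.mul_sum, h2,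
    Finset.sum_congr rfl fun ij hij => rePowTwelve_mul_theta hp hx hy h'
      (by rw [Finset.HasAntidiagonal.mem_antidiagonal.1 hij, hN]), ← Finset.mul_sum, h3,
    coeff_succ_X_mul] at h1
  linear_combination (-1 / 128) * h1

end

theorem rePowTwelve_sub_rePowTwelve {S : Type*} [CommRing S] {u v x y : S}
    (h : u ^ 2 + v ^ 2 = x ^ 2 + 3 * y ^ 2) :
    rePowTwelve (x ^ 2) (3 * y ^ 2) - rePowTwelve (u ^ 2) (v ^ 2) =
      8 * ((u ^ 2 - x ^ 2) * (v ^ 2 - x ^ 2) *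
        ((2 * u + x) ^ 2 - 9 * y ^ 2) * ((2 * u - x) ^ 2 - 9 * y ^ 2) *
        ((2 * v + x) ^ 2 - 9 * y ^ 2) * ((2 * v - x) ^ 2 - 9 * y ^ 2)) := by
  have hv : v ^ 2 = x ^ 2 + 3 * y ^ 2 - u ^ 2 := by linear_combination h
  have h1 : ((2 * v + x) ^ 2 - 9 * y ^ 2) * ((2 * v - x) ^ 2 - 9 * y ^ 2) =
      (4 * v ^ 2 + x ^ 2 - 9 * y ^ 2) ^ 2 - 16 * v ^ 2 * x ^ 2 := by ring
  rw [mul_assoc _ ((2 * v + x) ^ 2 - 9 * y ^ 2), h1, hv, rePowTwelve, rePowTwelve]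
  ring

end

/-- Twenty-sixth power: with `a n` the coefficient of `q^n` in
`∏ (1 - q^m)^{26}`, for every prime `p ≡ 1 (mod 12)` with `p = u² + v²`
(`u` odd, `v` even, both positive) and `p = x² + 3y²` (both positive), and
`κ = u` if `3 ∣ u`, `κ = v` otherwise, we have
`1019304 a_{(p-13)/12} = (-1)^κ (u²-x²)(v²-x²)((2u+x)²-9y²)((2u-x)²-9y²)
((2v+x)²-9y²)((2v-x)²-9y²)`; moreover the representing pairs are unique. -/
theorem stmt_19 (a : ℕ → ℤ)
    (ha : ∀ n N : ℕ, n ≤ N →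
      a n = (((∏ m ∈ Finset.Icc 1 N, ((1 : Polynomial ℤ) - Polynomial.X ^ m)) ^ 26).coeff n)) :
    (∀ p : ℕ, p.Prime → p % 12 = 1 →
      (∃! uv : ℕ × ℕ, 0 < uv.1 ∧ 0 < uv.2 ∧ Odd uv.1 ∧ Even uv.2 ∧
        p = uv.1 ^ 2 + uv.2 ^ 2) ∧
      (∃! xy : ℕ × ℕ, 0 < xy.1 ∧ 0 < xy.2 ∧ p = xy.1 ^ 2 + 3 * xy.2 ^ 2)) ∧
    ∀ p u v x y : ℕ, p.Prime → p % 12 = 1 →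
      0 < u → 0 < v → Odd u → Even v → p = u ^ 2 + v ^ 2 →
      0 < x → 0 < y → p = x ^ 2 + 3 * y ^ 2 →
      1019304 * a ((p - 13) / 12) =
        (-1) ^ (if u % 3 = 0 then u else v) *
          (((u : ℤ) ^ 2 - (x : ℤ) ^ 2) * ((v : ℤ) ^ 2 - (x : ℤ) ^ 2) *
            ((2 * (u : ℤ) + x) ^ 2 - 9 * (y : ℤ) ^ 2) *
            ((2 * (u : ℤ) - x) ^ 2 - 9 * (y : ℤ) ^ 2) *
            ((2 * (v : ℤ) + x) ^ 2 - 9 * (y : ℤ) ^ 2) *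
            ((2 * (v : ℤ) - x) ^ 2 - 9 * (y : ℤ) ^ 2)) := by
  refine ⟨fun p hp hmod => ⟨existsUnique_odd_sq_add_even_sq hp (by omega),
    existsUnique_sq_add_three_mul_sq hp (by omega)⟩, ?_⟩
  intro p u v x y hp hmod hu hv hu' hv' h hx hy h'
  have hN : 12 * ((p - 13) / 12 + 1) + 1 = p := by
    have := hp.one_lt
    omega
  have key := coeff_pentagonalSeries_pow_mul hp hu hv hu' hv' h hx hy h' hN
  rw [← intCast_eq_coeff_pentagonalSeries_pow ha, rePowTwelve_sub_rePowTwelve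
    (by exact_mod_cast h.symm.trans h')] at key
  have key' : (1019304 : ℂ) * a ((p - 13) / 12) = (-1) ^ (if u % 3 = 0 then u else v) *
      (((u : ℂ) ^ 2 - (x : ℂ) ^ 2) * ((v : ℂ) ^ 2 - (x : ℂ) ^ 2) *
        ((2 * (u : ℂ) + x) ^ 2 - 9 * (y : ℂ) ^ 2) * ((2 * (u : ℂ) - x) ^ 2 - 9 * (y : ℂ) ^ 2) *
        ((2 * (v : ℂ) + x) ^ 2 - 9 * (y : ℂ) ^ 2) * ((2 * (v : ℂ) - x) ^ 2 - 9 * (y : ℂ) ^ 2)) := by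
    linear_combination (1 / 8) * key
  exact_mod_cast key'
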